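/- Let G be a dihedral group of order 2n, where n ≥ 3 is odd. Then the set of positive catenary degrees Ca(G) of the monoid of product-one sequences B(G) equals the integer interval [2, 2n]. -/

import Mathlib

namespace ProductOne

open scoped Classical

variable {G : Type*} [Group G]

/-- `S` is a product-one sequence over `G`: its terms can be ordered with product `1`. -/
def IsProductOne (S : Multiset G) : Prop :=
  ∃ l : List G, (l : Multiset G) = S ∧ l.prod = 1

/-- `S` is an atom (a minimal product-one sequence): it is a nontrivial product-one
sequence that is not the concatenation of two nontrivial product-one sequences. -/
def IsAtomSeq (S : Multiset G) : Prop :=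
  S ≠ 0 ∧ IsProductOne S ∧
    ∀ A B : Multiset G, S = A + B → IsProductOne A → IsProductOne B → A = 0 ∨ B = 0

/-- `S` is a sequence over the subset `G₀ ⊆ G`. -/
def SeqOn (G₀ : Set G) (S : Multiset G) : Prop := ∀ g ∈ S, g ∈ G₀

/-- `S` is an atom of the monoid `B(G₀)` of product-one sequences over `G₀`. -/
def IsAtomSeqOn (G₀ : Set G) (S : Multiset G) : Prop := SeqOn G₀ S ∧ IsAtomSeq S

/-- The set of lengths `L(A)` of factorizations of `A` into atoms over `G₀`. -/
def lengthsOn (G₀ : Set G) (A : Multiset G) : Set ℕ :=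
  {k | ∃ f : Multiset (Multiset G), Multiset.card f = k ∧
        (∀ U ∈ f, IsAtomSeqOn G₀ U) ∧ f.sum = A}

/-- The set of lengths `L(A)` over the whole group. -/
def lengths (A : Multiset G) : Set ℕ := lengthsOn Set.univ A

/-- The set of distances of a set `L ⊆ ℕ`. -/
def distancesOf (L : Set ℕ) : Set ℕ :=
  {d | 0 < d ∧ ∃ a, a ∈ L ∧ a + d ∈ L ∧ ∀ b ∈ L, ¬(a < b ∧ b < a + d)}

/-- The set of distances `Δ(G₀)` of the monoid `B(G₀)`. -/
def DeltaOn (G₀ : Set G) : Set ℕ :=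
  {d | ∃ A : Multiset G, SeqOn G₀ A ∧ IsProductOne A ∧ d ∈ distancesOf (lengthsOn G₀ A)}

/-- The set of distances `Δ(G)` of `B(G)`. -/
def Delta (G : Type*) [Group G] : Set ℕ := DeltaOn (Set.univ : Set G)

/-- The large Davenport constant of `G₀`: maximal length of an atom of `B(G₀)`. -/
noncomputable def DavenportOn (G₀ : Set G) : ℕ :=
  sSup {k | ∃ S : Multiset G, IsAtomSeqOn G₀ S ∧ Multiset.card S = k}

/-- The large Davenport constant `D(G)`. -/
noncomputable def Davenport (G : Type*) [Group G] : ℕ :=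
  DavenportOn (Set.univ : Set G)

/-- The small Davenport constant `d(G₀)`: maximal length of a product-one free
sequence over `G₀`. -/
noncomputable def smallDavenportOn (G₀ : Set G) : ℕ :=
  sSup {k | ∃ S : Multiset G, SeqOn G₀ S ∧ Multiset.card S = k ∧
        ∀ T : Multiset G, T ≤ S → T ≠ 0 → ¬IsProductOne T}

/-- `Δ*(G) = {min Δ(G₀) : G₀ ⊆ G with Δ(G₀) ≠ ∅}`. -/
def DeltaStar (G : Type*) [Group G] : Set ℕ :=
  {d | ∃ G₀ : Set G, (DeltaOn G₀).Nonempty ∧ d = sInf (DeltaOn G₀)}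

/-- The elasticity `ρ(L) = max L / min L` of a set of lengths (with the set of
positive elements used, and `ρ = 1` if there are none). -/
noncomputable def elasticity (L : Set ℕ) : ℚ :=
  if (L ∩ {k | 0 < k}).Nonempty then
    ((sSup (L ∩ {k | 0 < k}) : ℕ) : ℚ) / ((sInf (L ∩ {k | 0 < k}) : ℕ) : ℚ)
  else 1

/-- The elasticity `ρ(G₀)` of the monoid `B(G₀)`. -/
noncomputable def rhoOn (G₀ : Set G) : ℝ :=
  sSup {x : ℝ | ∃ A : Multiset G, SeqOn G₀ A ∧ IsProductOne A ∧
    x = (elasticity (lengthsOn G₀ A) : ℝ)}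

/-- `Δ*_ρ(G) = {min Δ(G₀) : G₀ ⊆ G with ρ(G₀) = D(G)/2}`. -/
noncomputable def DeltaRhoStar (G : Type*) [Group G] : Set ℕ :=
  {d | ∃ G₀ : Set G, rhoOn G₀ = (Davenport G : ℝ) / 2 ∧ d = sInf (DeltaOn G₀)}

/-- Divisibility in the monoid `B(G)`. -/
def BDvd (A S : Multiset G) : Prop :=
  ∃ C : Multiset G, IsProductOne C ∧ S = A + C

/-- The `ω`-invariant `ω(B(G), A)`. -/
noncomputable def omegaAt (A : Multiset G) : ℕ∞ :=
  sInf {N : ℕ∞ | ∀ f : Multiset (Multiset G),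
    (∀ B ∈ f, IsProductOne B) → BDvd A f.sum →
    ∃ t ≤ f, (Multiset.card t : ℕ∞) ≤ N ∧ BDvd A t.sum}

/-- `ω(G) = sup {ω(B(G), U) : U an atom of B(G)}`. -/
noncomputable def omegaInv (G : Type*) [Group G] : ℕ∞ :=
  ⨆ U ∈ {U : Multiset G | IsAtomSeq U}, omegaAt U

/-- `z` is a factorization of `A` into atoms. -/
def IsFactorization (A : Multiset G) (z : Multiset (Multiset G)) : Prop :=
  (∀ U ∈ z, IsAtomSeq U) ∧ z.sum = A

/-- The distance between two factorizations. -/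
noncomputable def factDist (z z' : Multiset (Multiset G)) : ℕ :=
  letI := Classical.decEq (Multiset G)
  max (Multiset.card (z - z')) (Multiset.card (z' - z))

/-- The catenary degree `c(A)`. -/
noncomputable def catenaryAt (A : Multiset G) : ℕ∞ :=
  sInf {N : ℕ∞ | ∀ z z' : Multiset (Multiset G),
    IsFactorization A z → IsFactorization A z' →
    Relation.ReflTransGen
      (fun x y => IsFactorization A y ∧ (factDist x y : ℕ∞) ≤ N) z z'}

/-- The set of positive catenary degrees `Ca(G)`. -/
noncomputable def CatenarySet (G : Type*) [Group G] : Set ℕ∞ :=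
  {c | ∃ A : Multiset G, IsProductOne A ∧ catenaryAt A = c ∧ 0 < c}

/-- The catenary degree `c(G)` of `B(G)`. -/
noncomputable def catenaryDegree (G : Type*) [Group G] : ℕ∞ :=
  ⨆ A ∈ {A : Multiset G | IsProductOne A}, catenaryAt A

/-- The cross number `k(S)` of a sequence. -/
noncomputable def crossNumber (S : Multiset G) : ℚ :=
  (S.map fun g => (1 : ℚ) / (orderOf g : ℚ)).sum

/-- The system of sets of lengths `L(G)`. -/
def LSystem (G : Type*) [Group G] : Set (Set ℕ) :=
  {L | ∃ A : Multiset G, IsProductOne A ∧ L = lengths A}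

/-- The set of products `π(S)` of all orderings of the terms of `S`. -/
def piSet (S : Multiset G) : Set G :=
  {g | ∃ l : List G, (l : Multiset G) = S ∧ l.prod = g}

/-- The sumset `{x₁, -x₁} + ⋯ + {x_s, -x_s}` for a sequence `a = x₁ ⋯ x_s`. -/
def signedSums {α : Type*} [AddCommGroup α] (a : Multiset α) : Set α :=
  {z | ∃ t ≤ a, z = t.sum + t.sum - a.sum}

/-- `Σ_k(T)`: the set of sums of `k`-term subsequences of `T`. -/
def subseqSums {α : Type*} [AddCommMonoid α] (k : ℕ) (T : Multiset α) : Set α :=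
  {z | ∃ t ≤ T, Multiset.card t = k ∧ t.sum = z}

/-- The subsequence `S_X` of all terms of `S` lying in `X`. -/
noncomputable def restrictTo (X : Set G) (S : Multiset G) : Multiset G :=
  letI := Classical.decPred fun g => g ∈ X
  S.filter fun g => g ∈ X

/-- The maximum multiplicity `h(S)` of a term of `S`. -/
noncomputable def maxMultiplicity {α : Type*} (S : Multiset α) : ℕ :=
  letI := Classical.decEq α
  S.toFinset.sup S.count

end ProductOne

namespace ProductOne

open scoped Classical
open DihedralGroup

section Signed

variable {n : ℕ}

/-- The `ZMod n`-coordinate of an element of the dihedral group. -/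
def coord : DihedralGroup n → ZMod n
  | r a => a
  | sr b => b

/-- The indicator of the set of reflections. -/
def reflInd : DihedralGroup n → ℕ
  | r _ => 0
  | sr _ => 1

/-- An element of the dihedral group as a vector in `ZMod n × ℤ`; the second
coordinate tells rotations from reflections. -/
def vec (g : DihedralGroup n) : ZMod n × ℤ := (coord g, reflInd g)

/-- The vector of a signed element. -/
def svec (x : DihedralGroup n × Bool) : ZMod n × ℤ := if x.2 then vec x.1 else -vec x.1

/-- The sum of the vectors of a signed sequence. -/
def svecSum (M : Multiset (DihedralGroup n × Bool)) : ZMod n × ℤ := (M.map svec).sum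

/-- The number of reflections in a sequence. -/
def numRefl (S : Multiset (DihedralGroup n)) : ℕ := (S.map reflInd).sum

/-- A sequence is balanced if its terms can be given signs such that the signed sum of the
vectors vanishes. -/
def Balanced (S : Multiset (DihedralGroup n)) : Prop :=
  ∃ M : Multiset (DihedralGroup n × Bool), M.map Prod.fst = S ∧ svecSum M = 0

@[simp] lemma svecSum_zero : svecSum (0 : Multiset (DihedralGroup n × Bool)) = 0 := by
  simp [svecSum]

@[simp] lemma svecSum_cons (x) (M : Multiset (DihedralGroup n × Bool)) :
    svecSum (x ::ₘ M) = svec x + svecSum M := by simp [svecSum]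

@[simp] lemma svecSum_add (M N : Multiset (DihedralGroup n × Bool)) :
    svecSum (M + N) = svecSum M + svecSum N := by simp [svecSum]

@[simp] lemma svecSum_singleton (x : DihedralGroup n × Bool) : svecSum {x} = svec x := by
  simp [svecSum]

@[simp] lemma numRefl_zero : numRefl (0 : Multiset (DihedralGroup n)) = 0 := by simp [numRefl]

@[simp] lemma numRefl_cons (x) (M : Multiset (DihedralGroup n)) :
    numRefl (x ::ₘ M) = reflInd x + numRefl M := by simp [numRefl]

@[simp] lemma numRefl_add (M N : Multiset (DihedralGroup n)) :
    numRefl (M + N) = numRefl M + numRefl N := by simp [numRefl]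

@[simp] lemma numRefl_singleton (x : DihedralGroup n) : numRefl {x} = reflInd x := by
  simp [numRefl]

@[simp] lemma coord_r (a : ZMod n) : coord (r a) = a := rfl
@[simp] lemma coord_sr (a : ZMod n) : coord (sr a) = a := rfl
@[simp] lemma reflInd_r (a : ZMod n) : reflInd (r a) = 0 := rfl
@[simp] lemma reflInd_sr (a : ZMod n) : reflInd (sr a) = 1 := rfl
@[simp] lemma vec_fst (g : DihedralGroup n) : (vec g).1 = coord g := rfl
@[simp] lemma vec_snd (g : DihedralGroup n) : (vec g).2 = reflInd g := rfl
@[simp] lemma svec_true (g : DihedralGroup n) : svec (g, true) = vec g := by simp [svec]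
@[simp] lemma svec_false (g : DihedralGroup n) : svec (g, false) = -vec g := by simp [svec]

lemma reflInd_le_one (g : DihedralGroup n) : reflInd g ≤ 1 := by cases g <;> simp

lemma numRefl_le_card (S : Multiset (DihedralGroup n)) : numRefl S ≤ S.card := by
  induction S using Multiset.induction with
  | empty => simp
  | cons x S ih => have := reflInd_le_one x; simp; omega

lemma numRefl_mono {S T : Multiset (DihedralGroup n)} (h : S ≤ T) : numRefl S ≤ numRefl T := by
  obtain ⟨C, rfl⟩ := Multiset.le_iff_exists_add.1 h; simp

lemma numRefl_pos_iff {S : Multiset (DihedralGroup n)} : 0 < numRefl S ↔ ∃ b, sr b ∈ S := by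
  induction S using Multiset.induction with
  | empty => simp
  | cons x S ih =>
    cases x with
    | r a => simp [ih]
    | sr a => simp only [numRefl_cons, reflInd_sr, Multiset.mem_cons]
              exact ⟨fun _ => ⟨a, Or.inl rfl⟩, fun _ => by omega⟩

lemma vec_injective : Function.Injective (vec : DihedralGroup n → ZMod n × ℤ) := by
  intro g h e
  have h1 : coord g = coord h := congrArg Prod.fst e
  have h2 : (reflInd g : ℤ) = reflInd h := congrArg Prod.snd e
  cases g <;> cases h <;> simp_all

lemma vec_mul_of_rotation {g p : DihedralGroup n} (h : reflInd p = 0) :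
    vec (g * p) = vec g + vec p := by
  cases g <;> cases p <;> simp_all [vec, r_mul_r, sr_mul_r]

lemma vec_mul_of_reflection {g p : DihedralGroup n} (h : reflInd p = 1) :
    vec (g * p) = -vec g + vec p := by
  cases g <;> cases p <;> simp_all [vec, r_mul_sr, sr_mul_sr, sub_eq_neg_add]

lemma vec_one : vec (1 : DihedralGroup n) = 0 := rfl

lemma exists_signed_of_list (l : List (DihedralGroup n)) :
    ∃ M : Multiset (DihedralGroup n × Bool), M.map Prod.fst = ↑l ∧ svecSum M = vec l.prod := by
  induction l with
  | nil => exact ⟨0, by simp, by simp [vec_one]⟩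
  | cons g l ih =>
    obtain ⟨M, h1, h2⟩ := ih
    rcases Nat.le_one_iff_eq_zero_or_eq_one.1 (reflInd_le_one l.prod) with h | h
    · exact ⟨(g, true) ::ₘ M, by simp [h1], by simp [h2, vec_mul_of_rotation h]⟩
    · exact ⟨(g, false) ::ₘ M, by simp [h1], by simp [h2, vec_mul_of_reflection h]⟩

lemma IsProductOne.balanced {S : Multiset (DihedralGroup n)} (h : IsProductOne S) :
    Balanced S := by
  obtain ⟨l, rfl, hl⟩ := h
  obtain ⟨M, h1, h2⟩ := exists_signed_of_list l
  exact ⟨M, h1, by rw [h2, hl, vec_one]⟩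

lemma abs_svecSum_snd_le (M : Multiset (DihedralGroup n × Bool)) :
    |(svecSum M).2| ≤ numRefl (M.map Prod.fst) := by
  induction M using Multiset.induction with
  | empty => simp
  | cons x M ih =>
    obtain ⟨g, s⟩ := x
    rw [abs_le] at *
    cases s <;> simp <;> omega

lemma svecSum_snd_parity (M : Multiset (DihedralGroup n × Bool)) :
    (2 : ℤ) ∣ (svecSum M).2 - numRefl (M.map Prod.fst) := by
  induction M using Multiset.induction with
  | empty => simp
  | cons x M ih =>
    obtain ⟨g, s⟩ := x
    cases s <;> simp <;> omega

lemma svecSum_snd_eq_of_forall_pos {M : Multiset (DihedralGroup n × Bool)}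
    (h : ∀ b, (sr b, false) ∉ M) : (svecSum M).2 = numRefl (M.map Prod.fst) := by
  induction M using Multiset.induction with
  | empty => simp
  | cons x M ih =>
    have ih := ih (fun b hb => h b (Multiset.mem_cons_of_mem hb))
    rcases x with ⟨g | g, s⟩ <;> cases s <;> simp [ih]
    exact h g (Multiset.mem_cons_self _ _)

lemma svecSum_snd_eq_of_forall_neg {M : Multiset (DihedralGroup n × Bool)}
    (h : ∀ b, (sr b, true) ∉ M) : (svecSum M).2 = -numRefl (M.map Prod.fst) := by
  induction M using Multiset.induction with
  | empty => simp
  | cons x M ih =>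
    have ih := ih (fun b hb => h b (Multiset.mem_cons_of_mem hb))
    rcases x with ⟨g | g, s⟩ <;> cases s <;> simp [ih]
    · ring
    · exact absurd (Multiset.mem_cons_self _ _) (h g)

lemma exists_list_cons {M N : Multiset (DihedralGroup n × Bool)} {g : DihedralGroup n} {s : Bool}
    (hM : M = (g, s) ::ₘ N) (hs : (svecSum N).2 = if s then 0 else 1)
    (hN : ∃ l : List (DihedralGroup n), ↑l = N.map Prod.fst ∧ vec l.prod = svecSum N) :
    ∃ l : List (DihedralGroup n), ↑l = M.map Prod.fst ∧ vec l.prod = svecSum M := by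
  obtain ⟨l, h1, h2⟩ := hN
  refine ⟨g :: l, by simp [hM, ← h1], ?_⟩
  have h3 : (reflInd l.prod : ℤ) = (svecSum N).2 := congrArg Prod.snd h2
  cases s
  · rw [List.prod_cons, vec_mul_of_reflection (by simp_all), hM]; simp [h2]
  · rw [List.prod_cons, vec_mul_of_rotation (by simp_all), hM]; simp [h2]

lemma exists_list_of_signed (k : ℕ) : ∀ M : Multiset (DihedralGroup n × Bool), M.card = k →
    ((svecSum M).2 = 1 →
      ∃ l : List (DihedralGroup n), ↑l = M.map Prod.fst ∧ vec l.prod = svecSum M) ∧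
    ((svecSum M).2 = 0 → ((∃ b s, (sr b, s) ∈ M) ∨ ∀ a, (r a, false) ∉ M) →
      ∃ l : List (DihedralGroup n), ↑l = M.map Prod.fst ∧ vec l.prod = svecSum M) := by
  induction k with
  | zero =>
    intro M hM
    rw [Multiset.card_eq_zero] at hM
    subst hM
    exact ⟨by simp, fun _ _ => ⟨[], by simp [vec_one]⟩⟩
  | succ k ih =>
    intro M hM
    constructor
    · intro h1
      by_cases hr : ∃ a, (r a, false) ∈ M
      · obtain ⟨a, ha⟩ := hr
        obtain ⟨N, rfl⟩ := Multiset.exists_cons_of_mem ha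
        have hN : (svecSum N).2 = 1 := by simpa using h1
        exact exists_list_cons rfl (by simpa using hN) ((ih N (by simpa using hM)).1 hN)
      · push Not at hr
        have : ∃ b, (sr b, true) ∈ M := by
          by_contra! h
          have := svecSum_snd_eq_of_forall_neg h
          omega
        obtain ⟨b, hb⟩ := this
        obtain ⟨N, rfl⟩ := Multiset.exists_cons_of_mem hb
        have hN : (svecSum N).2 = 0 := by simpa using h1
        exact exists_list_cons rfl (by simpa using hN) ((ih N (by simpa using hM)).2 hN
          (Or.inr fun a ha => hr a (Multiset.mem_cons_of_mem ha)))
    · intro h0 hcase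
      by_cases hr : ∃ a, (r a, true) ∈ M
      · obtain ⟨a, ha⟩ := hr
        obtain ⟨N, rfl⟩ := Multiset.exists_cons_of_mem ha
        have hN : (svecSum N).2 = 0 := by simpa using h0
        exact exists_list_cons rfl (by simpa using hN) ((ih N (by simpa using hM)).2 hN
          (by simpa using hcase))
      · by_cases hs : ∃ b, (sr b, false) ∈ M
        · obtain ⟨b, hb⟩ := hs
          obtain ⟨N, rfl⟩ := Multiset.exists_cons_of_mem hb
          have hN : (svecSum N).2 = 1 := by simp at h0; omega
          exact exists_list_cons rfl (by simpa using hN) ((ih N (by simpa using hM)).1 hN)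
        · push Not at hr hs
          have h3 := svecSum_snd_eq_of_forall_pos hs
          have hno : ∀ b s, (sr b, s) ∉ M := by
            intro b s hb
            have : 0 < numRefl (M.map Prod.fst) :=
              numRefl_pos_iff.2 ⟨b, Multiset.mem_map.2 ⟨_, hb, rfl⟩⟩
            omega
          have hM0 : M = 0 := by
            refine Multiset.eq_zero_of_forall_notMem ?_
            rintro ⟨a | b, s⟩ hx
            · cases s
              · rcases hcase with ⟨b, s, h⟩ | h
                · exact hno _ _ h
                · exact h _ hx
              · exact hr _ hx
            · exact hno _ _ hx
          simp [hM0] at hM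

lemma Balanced.isProductOne {S : Multiset (DihedralGroup n)} (h : Balanced S)
    (hS : 0 < numRefl S) : IsProductOne S := by
  obtain ⟨M, rfl, hM⟩ := h
  obtain ⟨b, hb⟩ := numRefl_pos_iff.1 hS
  obtain ⟨⟨g, s⟩, hx, rfl⟩ := Multiset.mem_map.1 hb
  obtain ⟨l, h1, h2⟩ := (exists_list_of_signed _ M rfl).2 (by simp [hM]) (Or.inl ⟨b, s, hx⟩)
  exact ⟨l, h1, vec_injective (by rw [h2, hM, vec_one])⟩

lemma prod_eq_r_of_rotations (l : List (DihedralGroup n))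
    (h : ∀ g ∈ l, reflInd g = 0) : l.prod = r (l.map coord).sum := by
  induction l with
  | nil => simp [one_def, -r_zero]
  | cons g l ih =>
    have h1 := h g (by simp)
    have h2 := ih (fun g hg => h g (by simp [hg]))
    cases g <;> simp_all

lemma reflInd_eq_zero_of_numRefl {S : Multiset (DihedralGroup n)} (h : numRefl S = 0)
    {g : DihedralGroup n} (hg : g ∈ S) : reflInd g = 0 := by
  obtain ⟨C, rfl⟩ := Multiset.exists_cons_of_mem hg
  simp at h; omega

lemma isProductOne_iff_of_rotations {S : Multiset (DihedralGroup n)} (h : numRefl S = 0) :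
    IsProductOne S ↔ (S.map coord).sum = 0 := by
  have key : ∀ l : List (DihedralGroup n), ↑l = S → (l.prod = 1 ↔ (S.map coord).sum = 0) := by
    rintro l rfl
    rw [prod_eq_r_of_rotations l (fun g hg => reflInd_eq_zero_of_numRefl h (by simpa using hg)),
      one_def, r.injEq]
    simp
  constructor
  · rintro ⟨l, h1, h2⟩; exact (key l h1).1 h2
  · intro h2
    obtain ⟨l, hl⟩ := Quot.exists_rep S
    exact ⟨l, hl, (key l hl).2 h2⟩

lemma Balanced.even_numRefl {S : Multiset (DihedralGroup n)} (h : Balanced S) :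
    2 ∣ numRefl S := by
  obtain ⟨M, rfl, hM⟩ := h
  have := svecSum_snd_parity M
  simp [hM] at this
  omega

end Signed

section Multisets

variable {α β : Type*}

lemma exists_add_of_map_eq_add {f : α → β} {U W : Multiset β} : ∀ {X : Multiset α},
    X.map f = U + W → ∃ V Y, X = V + Y ∧ V.map f = U ∧ Y.map f = W := by
  induction U using Multiset.induction with
  | empty => intro X h; exact ⟨0, X, by simp, by simp, by simpa using h⟩
  | cons a U ih =>
    intro X h
    have ha : a ∈ X.map f := by simp [h]
    obtain ⟨x, hx, rfl⟩ := Multiset.mem_map.1 ha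
    obtain ⟨X, rfl⟩ := Multiset.exists_cons_of_mem hx
    obtain ⟨V, Y, rfl, rfl, rfl⟩ := ih (X := X) (by simpa using h)
    exact ⟨x ::ₘ V, Y, by simp, by simp, rfl⟩

lemma exists_family_of_sum_le_map {f : α → β} {s : Multiset (Multiset β)} : ∀ {X : Multiset α},
    s.sum ≤ X.map f → ∃ t : Multiset (Multiset α), t.sum ≤ X ∧ t.map (Multiset.map f) = s := by
  induction s using Multiset.induction with
  | empty => intro X _; exact ⟨0, by simp, by simp⟩
  | cons U s ih =>
    intro X h
    obtain ⟨W, hW⟩ := Multiset.le_iff_exists_add.1 h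
    rw [Multiset.sum_cons, add_assoc] at hW
    obtain ⟨V, Y, rfl, rfl, hY⟩ := exists_add_of_map_eq_add hW
    obtain ⟨t, ht, rfl⟩ := ih (X := Y) (by rw [hY]; exact Multiset.le_add_right _ _)
    exact ⟨V ::ₘ t, by simpa using ht, by simp⟩

/-- Deleting from a family of disjoint subsequences those that meet `R`. -/
lemma exists_subfamily_disjoint {s : Multiset (Multiset α)} {Z R : Multiset α} (hs : s.sum ≤ Z)
    (hR : R ≤ Z) : ∃ t ≤ s, s.card ≤ t.card + R.card ∧ t.sum + R ≤ Z := by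
  induction R using Multiset.induction with
  | empty => exact ⟨s, le_rfl, by simp, by simpa using hs⟩
  | cons x R ih =>
    obtain ⟨t, ht, hc, hle⟩ := ih ((Multiset.le_cons_self _ _).trans hR)
    by_cases hx : x ∈ t.sum
    · obtain ⟨U, hU, hxU⟩ : ∃ U ∈ t, x ∈ U := Multiset.mem_join.1 hx
      obtain ⟨t, rfl⟩ := Multiset.exists_cons_of_mem hU
      obtain ⟨U, rfl⟩ := Multiset.exists_cons_of_mem hxU
      refine ⟨t, (Multiset.le_cons_self _ _).trans ht, by simp at hc ⊢; omega, le_trans ?_ hle⟩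
      rw [Multiset.le_iff_exists_add]
      refine ⟨U, ?_⟩
      rw [Multiset.sum_cons]
      simp only [← Multiset.singleton_add]
      abel
    · refine ⟨t, ht, by simp; omega, Multiset.le_iff_count.2 fun y => ?_⟩
      have h1 := Multiset.le_iff_count.1 hle y
      have h2 := Multiset.le_iff_count.1 hR y
      by_cases hy : y = x
      · subst hy
        rw [Multiset.count_add, Multiset.count_eq_zero_of_notMem hx, zero_add]
        exact h2
      · rwa [Multiset.count_add, Multiset.count_cons_of_ne hy, ← Multiset.count_add]

lemma exists_subseq_sum_eq_zero {ι Q : Type*} [AddCommGroup Q] [Finite Q] (F : Multiset ι)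
    (d : ι → Q) (h : Nat.card Q ≤ F.card) : ∃ T ≤ F, T ≠ 0 ∧ (T.map d).sum = 0 := by
  obtain ⟨l, rfl⟩ := Quot.exists_rep F
  have := Fintype.ofFinite Q
  have hc : Fintype.card Q < Fintype.card (Fin (l.length + 1)) := by
    rw [← Nat.card_eq_fintype_card, Fintype.card_fin]
    exact Nat.lt_succ_of_le h
  obtain ⟨i, j, hij, he⟩ := Fintype.exists_ne_map_eq_of_card_lt
    (fun i : Fin (l.length + 1) => ((l.take i).map d).sum) hc
  wlog hlt : i < j generalizing i j
  · exact this j i hij.symm he.symm (lt_of_le_of_ne (not_lt.1 hlt) hij.symm)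
  have hsplit : l.take j = l.take i ++ (l.take j).drop i := by
    conv_lhs => rw [← List.take_append_drop i (l.take j)]
    rw [List.take_take, min_eq_left (by exact_mod_cast hlt.le)]
  refine ⟨((l.take j).drop i : List ι), ?_, ?_, ?_⟩
  · exact ((List.drop_sublist _ _).trans (List.take_sublist _ _)).subperm
  · have h1 : ((l.take j).drop i).length ≠ 0 := by
      have := j.2
      have : (i : ℕ) < j := hlt
      simp; omega
    simpa [← List.length_eq_zero_iff] using h1
  · rw [hsplit, List.map_append, List.sum_append] at he
    simpa using he

end Multisets

section Atoms

variable {G : Type*} [Group G]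

lemma isProductOne_zero : IsProductOne (0 : Multiset G) := ⟨[], rfl, rfl⟩

lemma IsProductOne.add {S T : Multiset G} (hS : IsProductOne S) (hT : IsProductOne T) :
    IsProductOne (S + T) := by
  obtain ⟨l, rfl, hl⟩ := hS
  obtain ⟨m, rfl, hm⟩ := hT
  exact ⟨l ++ m, by simp, by simp [hl, hm]⟩

lemma isProductOne_sum {z : Multiset (Multiset G)} (h : ∀ U ∈ z, IsProductOne U) :
    IsProductOne z.sum := by
  induction z using Multiset.induction with
  | empty => exact isProductOne_zero
  | cons U z ih =>
    rw [Multiset.sum_cons]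
    exact (h U (by simp)).add (ih fun V hV => h V (by simp [hV]))

lemma IsFactorization.add {A B : Multiset G} {z w : Multiset (Multiset G)}
    (hz : IsFactorization A z) (hw : IsFactorization B w) : IsFactorization (A + B) (z + w) := by
  refine ⟨fun U hU => ?_, by simp [hz.2, hw.2]⟩
  rcases Multiset.mem_add.1 hU with h | h
  exacts [hz.1 U h, hw.1 U h]

lemma IsAtomSeq.isFactorization {U : Multiset G} (h : IsAtomSeq U) : IsFactorization U {U} :=
  ⟨by simpa using h, by simp⟩

lemma IsFactorization.isProductOne {A : Multiset G} {z : Multiset (Multiset G)}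
    (hz : IsFactorization A z) : IsProductOne A := by
  rw [← hz.2]; exact isProductOne_sum fun U hU => (hz.1 U hU).2.1

lemma IsProductOne.exists_isFactorization {A : Multiset G} (hA : IsProductOne A) :
    ∃ z, IsFactorization A z := by
  induction hk : A.card using Nat.strong_induction_on generalizing A with
  | _ k ih =>
    by_cases hat : IsAtomSeq A
    · exact ⟨_, hat.isFactorization⟩
    by_cases h0 : A = 0
    · exact ⟨0, by simp, by simp [h0]⟩
    simp only [IsAtomSeq, not_and, not_forall, not_or] at hat
    obtain ⟨B, C, rfl, hB, hC, hB0, hC0⟩ := hat h0 hA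
    have h1 := Multiset.card_pos.2 hB0
    have h2 := Multiset.card_pos.2 hC0
    rw [Multiset.card_add] at hk
    obtain ⟨z, hz⟩ := ih B.card (by omega) hB rfl
    obtain ⟨w, hw⟩ := ih C.card (by omega) hC rfl
    exact ⟨_, hz.add hw⟩

lemma take_prod_injOn {l : List G} (hl : IsAtomSeq (l : Multiset G)) (h1 : l.prod = 1) :
    Set.InjOn (fun i => (l.take i).prod) (Set.Iio l.length) := by
  intro i hi j hj he
  by_contra hij
  wlog hlt : i < j generalizing i j
  · exact this hj hi he.symm (Ne.symm hij) (by omega)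
  simp only [Set.mem_Iio] at hi hj he
  have hsplit : l.take j = l.take i ++ (l.take j).drop i := by
    conv_lhs => rw [← List.take_append_drop i (l.take j)]
    rw [List.take_take, min_eq_left hlt.le]
  have hl' : l = l.take i ++ (l.take j).drop i ++ l.drop j := by
    rw [← hsplit, List.take_append_drop]
  have hm : ((l.take j).drop i).prod = 1 := by
    rw [hsplit, List.prod_append] at he
    simpa using he
  have hrest : (l.take i ++ l.drop j).prod = 1 := by
    rw [hl', List.prod_append, List.prod_append, hm, mul_one] at h1
    rw [List.prod_append, h1]
  have hsum : (l : Multiset G) =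
      ((l.take j).drop i : List G) + ((l.take i ++ l.drop j : List G) : Multiset G) := by
    conv_lhs => rw [hl']
    simp only [← Multiset.coe_add]
    abel
  rcases hl.2.2 _ _ hsum ⟨_, rfl, hm⟩ ⟨_, rfl, hrest⟩ with h | h
  · have := congrArg Multiset.card h
    simp at this
    omega
  · have := congrArg Multiset.card h
    simp at this
    omega

lemma IsAtomSeq.card_le [Fintype G] {S : Multiset G} (hS : IsAtomSeq S) :
    S.card ≤ Fintype.card G := by
  obtain ⟨l, rfl, hl⟩ := hS.2.1
  have := Finset.card_le_card_of_injOn (s := Finset.range l.length) (t := Finset.univ)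
    (fun i => (l.take i).prod) (by simp) (by simpa using take_prod_injOn hS hl)
  simpa using this

lemma exists_arcs_of_involution [Fintype G] {l : List G} (hl : IsAtomSeq (l : Multiset G))
    (h1 : l.prod = 1) (hc : Fintype.card G < 2 * l.length) {h : G} (hh : h * h = 1) (hne : h ≠ 1) :
    ∃ B C : List G, (l : Multiset G) = B + C ∧ B.prod = h ∧ C.prod = h := by
  have hinj := take_prod_injOn hl h1
  obtain ⟨i, j, hij, he⟩ : ∃ i j, i < j ∧ (l.take j).prod = (l.take i).prod * h := by
    obtain ⟨x, y, hxy, he⟩ := Fintype.exists_ne_map_eq_of_card_lt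
      (fun x : Fin l.length × Bool => (l.take x.1).prod * (if x.2 then h else 1))
      (by simpa [mul_comm] using hc)
    obtain ⟨⟨i, hi⟩, s⟩ := x
    obtain ⟨⟨j, hj⟩, t⟩ := y
    have hnoteq : ∀ i j : ℕ, (l.take j).prod = (l.take i).prod * h → i ≠ j := by
      rintro i j he rfl
      exact hne (by simpa using he)
    have aux : ∀ i j : ℕ, (l.take j).prod = (l.take i).prod * h →
        ∃ i j, i < j ∧ (l.take j).prod = (l.take i).prod * h := by
      intro i j he
      rcases lt_or_gt_of_ne (hnoteq i j he) with hlt | hlt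
      · exact ⟨i, j, hlt, he⟩
      · exact ⟨j, i, hlt, by rw [he, mul_assoc, hh, mul_one]⟩
    cases s <;> cases t <;> simp at he hxy
    · exact absurd (hinj hi hj he) hxy
    · exact aux _ _ he
    · exact aux _ _ he.symm
    · exact absurd (hinj hi hj he) hxy
  have hsplit : l.take j = l.take i ++ (l.take j).drop i := by
    conv_lhs => rw [← List.take_append_drop i (l.take j)]
    rw [List.take_take, min_eq_left hij.le]
  have hl' : l = l.take i ++ (l.take j).drop i ++ l.drop j := by
    rw [← hsplit, List.take_append_drop]
  have hm : ((l.take j).drop i).prod = h := by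
    rw [hsplit, List.prod_append] at he
    simpa using he
  refine ⟨(l.take j).drop i, l.drop j ++ l.take i, ?_, hm, ?_⟩
  · conv_lhs => rw [hl']
    simp only [← Multiset.coe_add]
    abel
  · rw [hl', List.prod_append, List.prod_append, hm] at h1
    rw [List.prod_append]
    have h2 := eq_inv_of_mul_eq_one_left h1
    have h3 : (l.take i).prod = (l.drop j).prod⁻¹ * h⁻¹ := by
      rw [← mul_inv_rev]; exact eq_inv_of_mul_eq_one_left (by rw [← mul_assoc]; exact h1)
    rw [h3, mul_inv_cancel_left, inv_eq_of_mul_eq_one_left hh]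

/-- A long atom can be shortened by exchanging with a product-one sequence that contains an
involution. -/
lemma IsAtomSeq.exchange [Fintype G] {V W : Multiset G} (hV : IsAtomSeq V)
    (hc : Fintype.card G < 2 * V.card) {h : G} (hh : h * h = 1) (hne : h ≠ 1)
    (hW : IsProductOne W) (hmem : h ∈ W) :
    ∃ V' W', IsProductOne V' ∧ IsProductOne W' ∧ V' ≠ 0 ∧ V + W = V' + W' ∧
      2 * V'.card ≤ V.card + 2 := by
  obtain ⟨l, rfl, hl⟩ := hV.2.1
  obtain ⟨m, rfl, hm⟩ := hW
  obtain ⟨s, t, rfl⟩ := List.append_of_mem (by simpa using hmem : h ∈ m)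
  obtain ⟨B, C, hBC, hB, hC⟩ := exists_arcs_of_involution hV hl (by simpa using hc) hh hne
  wlog hle : B.length ≤ C.length generalizing B C
  · exact this C B (by rw [hBC, add_comm]) hC hB (by omega)
  refine ⟨(h :: B : List G), (s ++ C ++ t : List G), ⟨_, rfl, by simp [hB, hh]⟩,
    ⟨_, rfl, by rw [← hm]; simp [hC]⟩, by simp, ?_, ?_⟩
  · rw [hBC]
    simp only [← Multiset.coe_add, ← Multiset.cons_coe, ← Multiset.singleton_add]
    abel
  · have := congrArg Multiset.card hBC
    simp at this ⊢
    omega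

end Atoms

section Resign

variable {n : ℕ}

lemma exists_resign (M : Multiset (DihedralGroup n × Bool)) (j : ℤ)
    (hj : |j| ≤ numRefl (M.map Prod.fst)) (hp : (2 : ℤ) ∣ j - numRefl (M.map Prod.fst)) :
    ∃ N : Multiset (DihedralGroup n × Bool), N.map Prod.fst = M.map Prod.fst ∧
      (svecSum N).2 = j := by
  induction M using Multiset.induction generalizing j with
  | empty => exact ⟨0, rfl, by simp at hj; simp [hj]⟩
  | cons x M ih =>
    obtain ⟨g, s⟩ := x
    rw [abs_le] at hj
    cases g with
    | r a =>
      obtain ⟨N, h1, h2⟩ := ih j (by rw [abs_le]; simpa using hj) (by simpa using hp)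
      exact ⟨(r a, true) ::ₘ N, by simp [h1], by simp [h2]⟩
    | sr b =>
      simp at hj hp
      by_cases h0 : 0 < j
      · obtain ⟨N, h1, h2⟩ := ih (j - 1) (by rw [abs_le]; omega) (by omega)
        exact ⟨(sr b, true) ::ₘ N, by simp [h1], by simp [h2]⟩
      · obtain ⟨N, h1, h2⟩ := ih (j + 1) (by rw [abs_le]; omega) (by omega)
        exact ⟨(sr b, false) ::ₘ N, by simp [h1], by simp [h2]⟩

end Resign

section SignedSums

variable {ι Q : Type*} [AddCommGroup Q]

/-- The set of signed sums of the values of `d` along `T`. -/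
def signedSumSet (d : ι → Q) (T : Multiset ι) : Set Q :=
  {x | ∃ T₁ T₂ : Multiset ι, T₁ + T₂ = T ∧ (T₁.map d).sum - (T₂.map d).sum = x}

lemma signedSumSet_nonempty (d : ι → Q) (T : Multiset ι) : (signedSumSet d T).Nonempty :=
  ⟨_, T, 0, by simp, rfl⟩

lemma add_mem_signedSumSet_cons {d : ι → Q} {T : Multiset ι} {x : Q} (h : x ∈ signedSumSet d T)
    (i : ι) : d i + x ∈ signedSumSet d (i ::ₘ T) := by
  obtain ⟨T₁, T₂, rfl, rfl⟩ := h
  exact ⟨i ::ₘ T₁, T₂, by simp, by simp; abel⟩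

lemma sub_mem_signedSumSet_cons {d : ι → Q} {T : Multiset ι} {x : Q} (h : x ∈ signedSumSet d T)
    (i : ι) : -d i + x ∈ signedSumSet d (i ::ₘ T) := by
  obtain ⟨T₁, T₂, rfl, rfl⟩ := h
  exact ⟨T₁, i ::ₘ T₂, by simp, by simp; abel⟩

lemma signedSumSet_subset {d : ι → Q} {T : Multiset ι} {H : AddSubgroup Q}
    (h : ∀ i ∈ T, d i ∈ H) : signedSumSet d T ⊆ H := by
  rintro _ ⟨T₁, T₂, rfl, rfl⟩
  refine H.sub_mem ?_ ?_ <;> refine H.multiset_sum_mem _ ?_ <;> simp only [Multiset.mem_map] <;>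
    rintro _ ⟨i, hi, rfl⟩ <;> exact h i (by simp [hi])

lemma exists_and_not_succ {P : ℕ → Prop} (h0 : P 0) {b : ℕ} (hb : ¬P b) : ∃ k, P k ∧ ¬P (k + 1) := by
  by_contra! h
  exact hb (Nat.rec h0 h b)

lemma mem_of_two_nsmul_mem [Finite Q] (hQ : Odd (Nat.card Q)) {S : AddSubgroup Q} {x : Q}
    (h : x + x ∈ S) : x ∈ S := by
  obtain ⟨k, hk⟩ := hQ
  have h1 : (k + 1) • (x + x) = x := by
    have := card_nsmul_eq_zero' (G := Q) (x := x)
    rw [← two_nsmul, ← mul_nsmul, show 2 * (k + 1) = Nat.card Q + 1 by omega, succ_nsmul, this,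
      zero_add]
  rw [← h1]
  exact S.nsmul_mem h _

lemma card_stabilizer_add_ncard_le [Finite Q] {B : Set Q} {H : AddSubgroup Q} (hB : B ⊆ H)
    (hne : B ≠ H) {S : AddSubgroup Q} (hS : ∀ s ∈ S, ∀ x ∈ B, s + x ∈ B) (hSH : S ≤ H) :
    Nat.card S + B.ncard ≤ Nat.card H := by
  obtain ⟨y, hy, hyB⟩ := Set.exists_of_ssubset (LE.le.ssubset_of_ne hB hne)
  have hdisj : Disjoint ((fun s => s + y) '' (S : Set Q)) B := by
    rw [Set.disjoint_left]
    rintro _ ⟨s, hs, rfl⟩ hsy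
    exact hyB (by simpa using hS (-s) (S.neg_mem hs) _ hsy)
  have h1 : ((fun s => s + y) '' (S : Set Q)).ncard = Nat.card S := by
    rw [Set.ncard_image_of_injective _ (add_left_injective y)]
    rfl
  rw [← h1, ← Set.ncard_union_eq hdisj (Set.toFinite _) (Set.toFinite _)]
  refine Set.ncard_le_ncard (Set.union_subset ?_ hB) (Set.toFinite _)
  rintro _ ⟨s, hs, rfl⟩
  exact H.add_mem (hSH hs) hy

lemma exists_subgroup_eq_signedSums_aux [Finite Q] (hQ : Odd (Nat.card Q)) (F : Multiset ι)
    (d : ι → Q) (hd : ∀ i ∈ F, d i ≠ 0) (k : ℕ) : ∀ H : AddSubgroup Q, Nat.card H = k → H ≠ ⊥ →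
    Nat.card H ≤ (F.filter (d · ∈ H)).card + 1 →
    ∃ H : AddSubgroup Q, H ≠ ⊥ ∧ ∃ T ≤ F, T.card + 1 ≤ Nat.card H ∧ (∀ i ∈ T, d i ∈ H) ∧
      ∀ x ∈ H, ∃ T₁ T₂ : Multiset ι, T₁ + T₂ = T ∧ (T₁.map d).sum - (T₂.map d).sum = x := by
  induction k using Nat.strong_induction_on with
  | _ k ih =>
    intro H hk hbot hcard
    set E := F.filter (d · ∈ H) with hE
    have hEH : ∀ T ≤ E, ∀ i ∈ T, d i ∈ H := fun T hT i hi =>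
      (Multiset.mem_filter.1 (Multiset.mem_of_le hT hi)).2
    obtain ⟨m, ⟨T, hTE, hTm, hT⟩, hmax⟩ := exists_and_not_succ
      (P := fun m => ∃ T ≤ E, T.card = m ∧ m + 1 ≤ (signedSumSet d T).ncard) (b := Nat.card H)
      ⟨0, by simp, by simp,
        (Set.ncard_pos (Set.toFinite _)).2 (signedSumSet_nonempty d 0)⟩ (by
        rintro ⟨T, hT, -, h⟩
        have : (signedSumSet d T).ncard ≤ Nat.card H :=
          Set.ncard_le_ncard (signedSumSet_subset (hEH T hT)) (Set.toFinite _)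
        omega)
    set B := signedSumSet d T with hB
    have hBH : B ⊆ H := signedSumSet_subset (hEH T hTE)
    have hBc : B.ncard ≤ Nat.card H := Set.ncard_le_ncard hBH (Set.toFinite _)
    by_cases hBeq : B = H
    · refine ⟨H, hbot, T, hTE.trans (Multiset.filter_le _ _), by omega, hEH T hTE, fun x hx => ?_⟩
      have : x ∈ B := by rw [hBeq]; exact hx
      exact this
    let S : AddSubgroup Q :=
      { carrier := {s | (∀ x ∈ B, s + x ∈ B) ∧ ∀ x ∈ B, -s + x ∈ B}
        add_mem' := fun {a b} ha hb =>
          ⟨fun x hx => by rw [add_assoc]; exact ha.1 _ (hb.1 _ hx),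
           fun x hx => by rw [neg_add, add_assoc]; exact ha.2 _ (hb.2 _ hx)⟩
        zero_mem' := by simp
        neg_mem' := fun {a} ha => ⟨ha.2, by simpa using ha.1⟩ }
    have hS : ∀ s ∈ S, ∀ x ∈ B, s + x ∈ B := fun s hs => hs.1
    obtain ⟨x₀, hx₀⟩ := signedSumSet_nonempty d T
    have hSH : S ≤ H := fun s hs => by
      have := H.sub_mem (hBH (hS s hs x₀ hx₀)) (hBH hx₀)
      simpa using this
    have hScard := card_stabilizer_add_ncard_le hBH hBeq hS hSH
    have hrest : ∀ i ∈ E - T, d i ∈ S := by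
      intro i hi
      have hle : i ::ₘ T ≤ E := by
        rw [← Multiset.singleton_add, ← tsub_add_cancel_of_le hTE]
        gcongr
        simpa using hi
      have hnc : (signedSumSet d (i ::ₘ T)).ncard ≤ B.ncard := by
        by_contra! h
        exact hmax ⟨i ::ₘ T, hle, by simp [hTm], by omega⟩
      have himg : ∀ y : Q, (∀ x ∈ B, y + x ∈ signedSumSet d (i ::ₘ T)) →
          (fun x => y + x) '' B = signedSumSet d (i ::ₘ T) := by
        intro y hy
        refine Set.eq_of_subset_of_ncard_le ?_ ?_ (Set.toFinite _)
        · rintro _ ⟨x, hx, rfl⟩; exact hy x hx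
        · rw [Set.ncard_image_of_injective _ (add_right_injective y)]; exact hnc
      have h1 := himg (d i) fun x hx => add_mem_signedSumSet_cons hx i
      have h2 := himg (-d i) fun x hx => sub_mem_signedSumSet_cons hx i
      refine mem_of_two_nsmul_mem hQ (S := S) ⟨fun x hx => ?_, fun x hx => ?_⟩
      · obtain ⟨y, hy, he⟩ : d i + x ∈ (fun x => -d i + x) '' B := by
          rw [h2, ← h1]; exact ⟨x, hx, rfl⟩
        have : y = d i + d i + x := by
          simp only at he
          rw [add_assoc, ← he]; abel
        rwa [← this]
      · obtain ⟨y, hy, he⟩ : -d i + x ∈ (fun x => d i + x) '' B := by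
          rw [h1, ← h2]; exact ⟨x, hx, rfl⟩
        have : y = -(d i + d i) + x := by
          simp only at he
          rw [neg_add, add_assoc, ← he]; abel
        rwa [← this]
    have hRcard : (E - T).card = E.card - T.card := Multiset.card_sub hTE
    have hSpos : 0 < Nat.card S := Nat.card_pos
    have hRle : E - T ≤ F.filter (d · ∈ S) :=
      Multiset.le_filter.2 ⟨(Multiset.sub_le_self _ _).trans (Multiset.filter_le _ _), hrest⟩
    have hRle' := Multiset.card_le_card hRle
    refine ih (Nat.card S) (by omega) S rfl ?_ (by omega)
    rintro hSbot
    obtain ⟨i, hi⟩ := Multiset.card_pos_iff_exists_mem.1 (show 0 < (E - T).card by omega)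
    have h0 := hrest i hi
    rw [hSbot, AddSubgroup.mem_bot] at h0
    exact hd i (Multiset.mem_of_le (hRle.trans (Multiset.filter_le _ _)) hi) h0

/-- Among sufficiently many nonzero elements of a group of odd order, some fill a nontrivial
subgroup by their signed sums. -/
lemma exists_subgroup_eq_signedSums [Finite Q] [Nontrivial Q] (hQ : Odd (Nat.card Q))
    (F : Multiset ι) (d : ι → Q) (hd : ∀ i ∈ F, d i ≠ 0) (hF : Nat.card Q ≤ F.card + 1) :
    ∃ H : AddSubgroup Q, H ≠ ⊥ ∧ ∃ T ≤ F, T.card + 1 ≤ Nat.card H ∧ (∀ i ∈ T, d i ∈ H) ∧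
      ∀ x ∈ H, ∃ T₁ T₂ : Multiset ι, T₁ + T₂ = T ∧ (T₁.map d).sum - (T₂.map d).sum = x :=
  exists_subgroup_eq_signedSums_aux hQ F d hd _ ⊤ rfl top_ne_bot (by
    rw [Multiset.filter_eq_self.2 (by simp)]
    simpa using hF)

end SignedSums

section Removal

variable {n : ℕ}

lemma svecSum_sum_fst (T : Multiset (Multiset (DihedralGroup n × Bool))) :
    (svecSum T.sum).1 = (T.map fun u => (svecSum u).1).sum := by
  induction T using Multiset.induction with
  | empty => simp
  | cons u T ih => simp [ih]

lemma svecSum_map_not (M : Multiset (DihedralGroup n × Bool)) :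
    svecSum (M.map fun x => (x.1, !x.2)) = -svecSum M := by
  induction M using Multiset.induction with
  | empty => simp
  | cons x M ih =>
    obtain ⟨g, s⟩ := x
    cases s <;> simp [ih] <;> abel

lemma svecSum_sum_snd_eq_zero {T : Multiset (Multiset (DihedralGroup n × Bool))}
    (h : ∀ u ∈ T, (svecSum u).2 = 0) : (svecSum T.sum).2 = 0 := by
  induction T using Multiset.induction with
  | empty => simp
  | cons u T ih => simp [h u (by simp), ih fun v hv => h v (by simp [hv])]

lemma card_sum_le {α : Type*} {T : Multiset (Multiset α)} {c : ℕ} (h : ∀ u ∈ T, u.card ≤ c) :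
    T.sum.card ≤ T.card * c := by
  induction T using Multiset.induction with
  | empty => simp
  | cons u T ih =>
    have h1 := h u (by simp)
    have h2 := ih fun v hv => h v (by simp [hv])
    rw [Multiset.sum_cons, Multiset.card_add, Multiset.card_cons, add_mul]
    omega

lemma le_card_sum {α : Type*} {T : Multiset (Multiset α)} {c : ℕ} (h : ∀ u ∈ T, c ≤ u.card) :
    T.card * c ≤ T.sum.card := by
  induction T using Multiset.induction with
  | empty => simp
  | cons u T ih =>
    have h1 := h u (by simp)
    have h2 := ih fun v hv => h v (by simp [hv])
    rw [Multiset.sum_cons, Multiset.card_add, Multiset.card_cons, add_mul]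
    omega

/-- `F` is a family of pieces of length at most two, each without influence on the second
coordinate, whose signed sums are exactly the elements of `K`. -/
structure Fills (F : Multiset (Multiset (DihedralGroup n × Bool))) (K : AddSubgroup (ZMod n)) :
    Prop where
  card_le : ∀ u ∈ F, u.card ≤ 2
  snd_eq : ∀ u ∈ F, (svecSum u).2 = 0
  fst_mem : ∀ u ∈ F, (svecSum u).1 ∈ K
  card_lt : F.card + 1 ≤ Nat.card K
  fill : ∀ x ∈ K, ∃ T₁ T₂, T₁ + T₂ = F ∧ (svecSum T₁.sum).1 - (svecSum T₂.sum).1 = x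

lemma fills_bot : Fills (0 : Multiset (Multiset (DihedralGroup n × Bool))) ⊥ where
  card_le := by simp
  snd_eq := by simp
  fst_mem := by simp
  card_lt := by simp
  fill := fun x hx => ⟨0, 0, by simp, by simpa using hx.symm⟩

lemma Fills.balanced {F : Multiset (Multiset (DihedralGroup n × Bool))} {K : AddSubgroup (ZMod n)}
    (hF : Fills F K) {M : Multiset (DihedralGroup n × Bool)} (h2 : (svecSum M).2 = 0)
    (h1 : (svecSum M).1 ∈ K) : Balanced ((F.sum + M).map Prod.fst) := by
  obtain ⟨T₁, T₂, rfl, hT⟩ := hF.fill _ (K.neg_mem h1)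
  refine ⟨T₁.sum + T₂.sum.map (fun x => (x.1, !x.2)) + M, by simp [Multiset.map_map], ?_⟩
  have e1 : (svecSum T₁.sum).2 = 0 := svecSum_sum_snd_eq_zero fun u hu => hF.snd_eq u (by simp [hu])
  have e2 : (svecSum T₂.sum).2 = 0 := svecSum_sum_snd_eq_zero fun u hu => hF.snd_eq u (by simp [hu])
  rw [svecSum_add, svecSum_add, svecSum_map_not]
  ext
  · simp only [Prod.fst_add, Prod.fst_neg, Prod.fst_zero]
    rw [← sub_eq_add_neg, hT, neg_add_cancel]
  · simp [e1, e2, h2]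

lemma Fills.sum_fst_mem {F : Multiset (Multiset (DihedralGroup n × Bool))}
    {K : AddSubgroup (ZMod n)} (hF : Fills F K) : (svecSum F.sum).1 ∈ K := by
  rw [svecSum_sum_fst]
  refine K.multiset_sum_mem _ ?_
  simp only [Multiset.mem_map]
  rintro _ ⟨u, hu, rfl⟩
  exact hF.fst_mem u hu

lemma card_comap_mk [NeZero n] (K : AddSubgroup (ZMod n)) (H : AddSubgroup (ZMod n ⧸ K)) :
    Nat.card (H.comap (QuotientAddGroup.mk' K)) = Nat.card K * Nat.card H := by
  have h1 := K.card_mul_index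
  have h2 := (H.comap (QuotientAddGroup.mk' K)).card_mul_index
  have h3 := H.card_mul_index
  have h4 : (H.comap (QuotientAddGroup.mk' K)).index = H.index :=
    AddSubgroup.index_comap_of_surjective H (QuotientAddGroup.mk'_surjective K)
  have h5 : Nat.card (ZMod n ⧸ K) = K.index := rfl
  have h6 : 0 < H.index := Nat.pos_of_ne_zero AddSubgroup.index_ne_zero_of_finite
  rw [h4] at h2
  rw [h5] at h3
  refine Nat.eq_of_mul_eq_mul_right h6 ?_
  rw [h2, mul_assoc, h3, h1]

lemma Fills.grow [NeZero n] (hn : Odd n) {F F' : Multiset (Multiset (DihedralGroup n × Bool))}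
    {K : AddSubgroup (ZMod n)} (hF : Fills F K) (hK : K ≠ ⊤) (hc : ∀ u ∈ F', u.card ≤ 2)
    (h2 : ∀ u ∈ F', (svecSum u).2 = 0) (h1 : ∀ u ∈ F', (svecSum u).1 ∉ K)
    (hi : K.index ≤ F'.card + 1) :
    ∃ (K' : AddSubgroup (ZMod n)) (T : Multiset (Multiset (DihedralGroup n × Bool))),
      T ≤ F' ∧ Nat.card K < Nat.card K' ∧ Fills (F + T) K' := by
  have hcardQ : Nat.card (ZMod n ⧸ K) = K.index := rfl
  have hindex : K.index ≠ 1 := fun h => hK (AddSubgroup.index_eq_one.1 h)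
  have hindex0 : K.index ≠ 0 := AddSubgroup.index_ne_zero_of_finite
  have hdvd := K.card_mul_index
  rw [Nat.card_zmod] at hdvd
  have hodd : Odd (Nat.card (ZMod n ⧸ K)) := by
    rw [hcardQ]; exact Odd.of_dvd_nat hn ⟨_, by rw [mul_comm]; exact hdvd.symm⟩
  have : Nontrivial (ZMod n ⧸ K) := by
    rw [← Finite.one_lt_card_iff_nontrivial, hcardQ]; omega
  obtain ⟨H, hH, T, hTF, hTc, hTH, hfill⟩ := exists_subgroup_eq_signedSums hodd F'
    (fun u => ((svecSum u).1 : ZMod n ⧸ K))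
    (fun u hu => by rw [Ne, QuotientAddGroup.eq_zero_iff]; exact h1 u hu) (by rw [hcardQ]; exact hi)
  have hHc : 1 < Nat.card H := by
    have := AddSubgroup.card_le_one_iff_eq_bot (G := ZMod n ⧸ K) H
    by_contra! h
    exact hH (this.1 h)
  have hKpos : 0 < Nat.card K := Nat.card_pos
  have hmk : ∀ T : Multiset (Multiset (DihedralGroup n × Bool)),
      (T.map fun u => ((svecSum u).1 : ZMod n ⧸ K)).sum = ((svecSum T.sum).1 : ZMod n ⧸ K) := by
    intro T
    induction T using Multiset.induction with
    | empty => simp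
    | cons u T ih => simp [ih]
  have hFc := hF.card_lt
  refine ⟨H.comap (QuotientAddGroup.mk' K), T, hTF, ?_, ?_, ?_, ?_, ?_, ?_⟩
  · rw [card_comap_mk]; nlinarith
  · intro u hu
    rcases Multiset.mem_add.1 hu with h | h
    exacts [hF.card_le u h, hc u (Multiset.mem_of_le hTF h)]
  · intro u hu
    rcases Multiset.mem_add.1 hu with h | h
    exacts [hF.snd_eq u h, h2 u (Multiset.mem_of_le hTF h)]
  · intro u hu
    rw [AddSubgroup.mem_comap, QuotientAddGroup.mk'_apply]
    rcases Multiset.mem_add.1 hu with h | h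
    · rw [(QuotientAddGroup.eq_zero_iff _).2 (hF.fst_mem u h)]; exact H.zero_mem
    · exact hTH u h
  · rw [card_comap_mk, Multiset.card_add]
    nlinarith
  · intro x hx
    obtain ⟨T₁, T₂, rfl, hT⟩ := hfill _ hx
    rw [hmk, hmk, QuotientAddGroup.mk'_apply, ← QuotientAddGroup.mk_sub, eq_comm, ← sub_eq_zero,
      ← QuotientAddGroup.mk_sub, QuotientAddGroup.eq_zero_iff] at hT
    obtain ⟨F₁, F₂, rfl, hF'⟩ := hF.fill _ hT
    refine ⟨F₁ + T₁, F₂ + T₂, by abel, ?_⟩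
    simp only [Multiset.sum_add, svecSum_add, Prod.fst_add]
    rw [add_sub_add_comm, hF']
    abel

lemma svecSum_fst_sub_mem {K : AddSubgroup (ZMod n)} {c : ZMod n}
    {M : Multiset (DihedralGroup n × Bool)}
    (h : ∀ g ∈ M.map Prod.fst, coord g - reflInd g • c ∈ K) :
    (svecSum M).1 - (svecSum M).2 • c ∈ K := by
  induction M using Multiset.induction with
  | empty => simp
  | cons x M ih =>
    have h2 := ih fun g hg => h g (by simp at hg ⊢; exact Or.inr hg)
    have h1 := h x.1 (by simp)
    obtain ⟨g, s⟩ := x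
    cases s
    · have := K.sub_mem h2 h1
      convert this using 1
      simp [add_smul]
      abel
    · have := K.add_mem h2 h1
      convert this using 1
      simp [add_smul]
      abel

end Removal

section Removal

variable {n : ℕ}

/-- If all small pieces of `L` have their coordinate in `K`, a piece can be cut out of `L` and
the signs of the rest rearranged without leaving the coset of `K`. -/
lemma exists_resign_remove {K : AddSubgroup (ZMod n)} {L U V W : Multiset (DihedralGroup n × Bool)}
    (hL : L = U + (V + W)) (hrot : ∀ a t, (r a, t) ∈ L → a ∈ K)
    (hrefl : ∀ a b, (sr a, true) ∈ L → (sr b, false) ∈ L → a - b ∈ K)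
    (hU : |(svecSum L).2| ≤ |(svecSum U).2|) (hV : |(svecSum L).2| ≤ |(svecSum V).2|)
    (hev : 2 ∣ numRefl (U.map Prod.fst)) :
    ∃ N : Multiset (DihedralGroup n × Bool), N.map Prod.fst = (V + W).map Prod.fst ∧
      (svecSum N).2 = (svecSum L).2 ∧ (svecSum N).1 - (svecSum L).1 ∈ K := by
  have hnum : numRefl (L.map Prod.fst) = numRefl (U.map Prod.fst) + numRefl ((V + W).map Prod.fst)
    := by simp [hL]
  have hVW : numRefl ((V + W).map Prod.fst) =
    numRefl (V.map Prod.fst) + numRefl (W.map Prod.fst) := by simp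
  have aU := abs_svecSum_snd_le U
  have aV := abs_svecSum_snd_le V
  obtain ⟨c, hc⟩ : ∃ c, ∀ b t, (sr b, t) ∈ L → b - c ∈ K := by
    have hnone : (|(svecSum L).2| = numRefl (L.map Prod.fst)) → ∀ b t, (sr b, t) ∉ L := by
      intro h b t hb
      have h3 : 0 < numRefl (L.map Prod.fst) :=
        numRefl_pos_iff.2 ⟨b, Multiset.mem_map.2 ⟨_, hb, rfl⟩⟩
      omega
    by_cases hpos : ∃ a, (sr a, true) ∈ L
    · by_cases hneg : ∃ b, (sr b, false) ∈ L
      · obtain ⟨a, ha⟩ := hpos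
        obtain ⟨b, hb⟩ := hneg
        refine ⟨a, fun x t hx => ?_⟩
        cases t
        · have := K.neg_mem (hrefl a x ha hx)
          simpa using this
        · have := K.sub_mem (hrefl x b hx hb) (hrefl a b ha hb)
          simpa using this
      · push Not at hneg
        have h := svecSum_snd_eq_of_forall_pos hneg
        exact ⟨0, fun b t hb => absurd hb (hnone (by rw [h]; simp) b t)⟩
    · push Not at hpos
      have h := svecSum_snd_eq_of_forall_neg hpos
      exact ⟨0, fun b t hb => absurd hb (hnone (by rw [h]; simp) b t)⟩
  have hp := svecSum_snd_parity L
  obtain ⟨N, hN1, hN2⟩ := exists_resign (V + W) (svecSum L).2 (by omega) (by omega)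
  refine ⟨N, hN1, hN2, ?_⟩
  have hcos : ∀ g ∈ L.map Prod.fst, coord g - reflInd g • c ∈ K := by
    intro g hg
    obtain ⟨⟨g, t⟩, hx, rfl⟩ := Multiset.mem_map.1 hg
    cases g with
    | r a => simpa using hrot a t hx
    | sr b => simpa using hc b t hx
  have e1 := svecSum_fst_sub_mem hcos
  have e2 := svecSum_fst_sub_mem (M := N) (K := K) (c := c) (fun g hg => hcos g (by
    rw [hN1] at hg
    rw [hL, Multiset.map_add]
    exact Multiset.mem_add.2 (Or.inr hg)))
  have := K.sub_mem e2 e1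
  rw [hN2] at this
  simpa using this

lemma exists_max_fills [NeZero n] (Z : Multiset (DihedralGroup n × Bool)) :
    ∃ (K : AddSubgroup (ZMod n)) (F : Multiset (Multiset (DihedralGroup n × Bool))),
      Fills F K ∧ F.sum ≤ Z ∧ ∀ K' F', Fills F' K' → F'.sum ≤ Z → Nat.card K' ≤ Nat.card K := by
  obtain ⟨K, ⟨F, hF, hFZ⟩, hmax⟩ := Set.exists_max_image
    {K : AddSubgroup (ZMod n) | ∃ F, Fills F K ∧ F.sum ≤ Z} (fun K => Nat.card K)
    (Set.toFinite _) ⟨⊥, 0, fills_bot, by simp⟩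
  exact ⟨K, F, hF, hFZ, fun K' F' h1 h2 => hmax K' ⟨F', h1, h2⟩⟩

lemma exists_max_extra [NeZero n] (hn : Odd n) {K : AddSubgroup (ZMod n)}
    {F : Multiset (Multiset (DihedralGroup n × Bool))} {M : Multiset (DihedralGroup n × Bool)}
    (hF : Fills F K) (hK : K ≠ ⊤)
    (hmax : ∀ K' F', Fills F' K' → F'.sum ≤ F.sum + M → Nat.card K' ≤ Nat.card K) :
    ∃ (E : Multiset (Multiset (DihedralGroup n × Bool))) (L : Multiset (DihedralGroup n × Bool)),
      M = E.sum + L ∧ E.card + 2 ≤ K.index ∧ (∀ u ∈ E, u.card ≤ 2) ∧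
      (∀ u ∈ E, (svecSum u).2 = 0) ∧ (∀ a t, (r a, t) ∈ L → a ∈ K) ∧
      (∀ a b, (sr a, true) ∈ L → (sr b, false) ∈ L → a - b ∈ K) := by
  have hgrow : ∀ E : Multiset (Multiset (DihedralGroup n × Bool)), E.sum ≤ M →
      (∀ u ∈ E, u.card ≤ 2 ∧ (svecSum u).2 = 0 ∧ (svecSum u).1 ∉ K) → E.card + 2 ≤ K.index := by
    intro E hE h
    by_contra hlt
    obtain ⟨K', T, hT, hlt', hfill⟩ := hF.grow hn hK (fun u hu => (h u hu).1)
      (fun u hu => (h u hu).2.1) (fun u hu => (h u hu).2.2) (by omega)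
    refine absurd (hmax K' _ hfill ?_) (by omega)
    rw [Multiset.sum_add]
    gcongr
    obtain ⟨T', rfl⟩ := Multiset.le_iff_exists_add.1 hT
    rw [Multiset.sum_add] at hE
    exact (Multiset.le_add_right _ _).trans hE
  obtain ⟨k, ⟨E, hEk, hEM, hE⟩, hk⟩ := exists_and_not_succ
    (P := fun k => ∃ E : Multiset (Multiset (DihedralGroup n × Bool)), E.card = k ∧ E.sum ≤ M ∧
      ∀ u ∈ E, u.card ≤ 2 ∧ (svecSum u).2 = 0 ∧ (svecSum u).1 ∉ K) (b := K.index)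
    ⟨0, by simp, by simp, by simp⟩ (by
      rintro ⟨E, h1, h2, h3⟩
      have := hgrow E h2 h3
      omega)
  obtain ⟨L, rfl⟩ := Multiset.le_iff_exists_add.1 hEM
  have hpiece : ∀ u ≤ L, u.card ≤ 2 → (svecSum u).2 = 0 → (svecSum u).1 ∈ K := by
    intro u hu h1 h2
    by_contra h3
    refine hk ⟨u ::ₘ E, by simp [hEk], ?_, ?_⟩
    · rw [Multiset.sum_cons, add_comm]
      gcongr
    · intro v hv
      rcases Multiset.mem_cons.1 hv with rfl | hv
      exacts [⟨h1, h2, h3⟩, hE v hv]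
  refine ⟨E, L, rfl, hgrow E hEM hE, fun u hu => (hE u hu).1, fun u hu => (hE u hu).2.1, ?_, ?_⟩
  · intro a t ha
    have := hpiece {(r a, t)} (by simpa using ha) (by simp) (by cases t <;> simp)
    cases t <;> simpa using this
  · intro a b ha hb
    have := hpiece {(sr a, true), (sr b, false)} (by
      obtain ⟨C, rfl⟩ := Multiset.exists_cons_of_mem ha
      have hb' : (sr b, false) ∈ C := by simpa using hb
      obtain ⟨D, rfl⟩ := Multiset.exists_cons_of_mem hb'
      exact Multiset.cons_le_cons _ (by simp)) (by simp)
      (by simp [Multiset.insert_eq_cons])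
    simpa [Multiset.insert_eq_cons, sub_eq_add_neg] using this

/-- From a balanced signed sequence without identity elements that contains many disjoint pieces,
one of the pieces can be removed, or an element occurs with both signs. -/
lemma exists_removable (hn : Odd n) {X : Multiset (DihedralGroup n × Bool)}
    (hX : svecSum X = 0) {s : Multiset (Multiset (DihedralGroup n × Bool))} (hs : s.sum ≤ X)
    (hc : n + 1 ≤ s.card) (hev : ∀ U ∈ s, 2 ∣ numRefl (U.map Prod.fst))
    (hcard : ∀ U ∈ s, 2 ≤ U.card) (h0 : ∀ t, (r 0, t) ∉ X) :
    (∃ U ∈ s, ∃ W, X = U + W ∧ Balanced (W.map Prod.fst)) ∨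
      (s.card < 2 * n - 1 ∧ ∃ b, (sr b, true) ∈ X ∧ (sr b, false) ∈ X) := by
  have : NeZero n := ⟨by rintro rfl; simp at hn⟩
  have hnpos : 0 < n := Nat.pos_of_ne_zero (NeZero.ne n)
  obtain ⟨U₀, hU₀, hmin⟩ : ∃ U₀ ∈ s, ∀ U ∈ s, |(svecSum U₀).2| ≤ |(svecSum U).2| := by
    obtain ⟨U₀, h1, h2⟩ := Finset.exists_min_image s.toFinset (fun U => |(svecSum U).2|) (by
      rw [Multiset.toFinset_nonempty]; rintro rfl; simp at hc)
    exact ⟨U₀, by simpa using h1, fun U hU => h2 U (by simpa using hU)⟩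
  obtain ⟨s₁, rfl⟩ := Multiset.exists_cons_of_mem hU₀
  obtain ⟨Y, hY⟩ := Multiset.le_iff_exists_add.1 hs
  rw [Multiset.sum_cons, add_assoc] at hY
  obtain ⟨Z, hZ⟩ : ∃ Z, Z = s₁.sum + Y := ⟨_, rfl⟩
  rw [← hZ] at hY
  have hsZ : s₁.sum ≤ Z := by rw [hZ]; exact Multiset.le_add_right _ _
  obtain ⟨K, F, hF, hFZ, hmax⟩ := exists_max_fills Z
  obtain ⟨M, rfl⟩ := Multiset.le_iff_exists_add.1 hFZ
  rw [hY, svecSum_add, svecSum_add] at hX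
  have hF2 : (svecSum F.sum).2 = 0 := svecSum_sum_snd_eq_zero hF.snd_eq
  have hX2 : (svecSum U₀).2 + ((svecSum F.sum).2 + (svecSum M).2) = 0 := by
    simpa using congrArg Prod.snd hX
  have hX1 : (svecSum U₀).1 + ((svecSum F.sum).1 + (svecSum M).1) = 0 := by
    simpa using congrArg Prod.fst hX
  have hpU := svecSum_snd_parity U₀
  have hevU := hev U₀ hU₀
  rw [Multiset.card_cons] at hc
  by_cases hK : K = ⊤
  · left
    have hp := svecSum_snd_parity M
    obtain ⟨N, hN1, hN2⟩ := exists_resign M 0 (by simp) (by omega)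
    refine ⟨U₀, hU₀, F.sum + M, hY, ?_⟩
    have := hF.balanced hN2 (by simp [hK])
    simpa [hN1] using this
  obtain ⟨E, L, rfl, hEc, hE2, hE0, hrot, hrefl⟩ := exists_max_extra hn hF hK hmax
  have hEsum : (svecSum E.sum).2 = 0 := svecSum_sum_snd_eq_zero hE0
  simp only [svecSum_add, Prod.snd_add, Prod.fst_add] at hX2 hX1
  have hL2 : (svecSum L).2 = -(svecSum U₀).2 := by omega
  have hindex := K.card_mul_index
  rw [Nat.card_zmod] at hindex
  have hFc := hF.card_lt
  have hFs := card_sum_le hF.card_le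
  have hEs := card_sum_le hE2
  by_cases hA : 2 ≤ Nat.card K ∨ 2 * n - 1 ≤ s₁.card + 1
  · left
    obtain ⟨t, hts, htc, htsum⟩ := exists_subfamily_disjoint (R := F.sum + E.sum) hsZ
      (by rw [← add_assoc]; exact Multiset.le_add_right _ _)
    have htL : t.sum ≤ L := by
      rw [← add_assoc F.sum, add_comm t.sum] at htsum
      exact (add_le_add_iff_left _).1 htsum
    have ht2 : 2 ≤ t.card := by
      rw [Multiset.card_add] at htc
      generalize Nat.card K = k at *
      generalize K.index = m at *
      rcases hA with hk | hk
      · have : 2 * k + 2 * m ≤ n + 4 := by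
          obtain ⟨k, rfl⟩ := Nat.exists_eq_add_of_le hk
          obtain ⟨m, rfl⟩ := Nat.exists_eq_add_of_le (show 2 ≤ m by omega)
          nlinarith
        omega
      · have : k + m ≤ n + 1 := by
          obtain ⟨k, rfl⟩ := Nat.exists_eq_add_of_le (show 1 ≤ k by omega)
          obtain ⟨m, rfl⟩ := Nat.exists_eq_add_of_le (show 2 ≤ m by omega)
          nlinarith
        omega
    obtain ⟨U, t, rfl⟩ : ∃ U t', t = U ::ₘ t' := by
      obtain ⟨U, hU⟩ := Multiset.card_pos_iff_exists_mem.1 (show 0 < t.card by omega)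
      exact ⟨U, Multiset.exists_cons_of_mem hU⟩
    obtain ⟨V, t, rfl⟩ : ∃ V t', t = V ::ₘ t' := by
      rw [Multiset.card_cons] at ht2
      obtain ⟨U, hU⟩ := Multiset.card_pos_iff_exists_mem.1 (show 0 < t.card by omega)
      exact ⟨U, Multiset.exists_cons_of_mem hU⟩
    obtain ⟨W, hW⟩ := Multiset.le_iff_exists_add.1 htL
    have hUs : U ∈ U₀ ::ₘ s₁ := Multiset.mem_cons_of_mem (Multiset.mem_of_le hts (by simp))
    have hVs : V ∈ U₀ ::ₘ s₁ := Multiset.mem_cons_of_mem (Multiset.mem_of_le hts (by simp))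
    have hL : L = U + (V + (t.sum + W)) := by
      rw [hW, Multiset.sum_cons, Multiset.sum_cons]; abel
    obtain ⟨N, hN1, hN2, hN3⟩ := exists_resign_remove hL hrot hrefl
      (by rw [hL2, abs_neg]; exact hmin U hUs) (by rw [hL2, abs_neg]; exact hmin V hVs) (hev U hUs)
    refine ⟨U, hUs, U₀ + F.sum + E.sum + (V + (t.sum + W)), by rw [hY, hL]; abel, ?_⟩
    have := hF.balanced (M := U₀ + E.sum + N) (by simp [hN2, hEsum, hL2]) (by
      have h1 := K.sub_mem hN3 hF.sum_fst_mem
      convert h1 using 1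
      simp only [svecSum_add, Prod.fst_add]
      linear_combination hX1)
    convert this using 1
    simp only [Multiset.map_add, hN1]
    abel
  · right
    push Not at hA
    refine ⟨by rw [Multiset.card_cons]; omega, ?_⟩
    have hKc : Nat.card K = 1 := by have := Nat.card_pos (α := K); omega
    have hKbot : K = ⊥ := (AddSubgroup.card_le_one_iff_eq_bot K).1 (by omega)
    subst hKbot
    rw [hKc, one_mul] at hindex
    have hLX : ∀ x ∈ L, x ∈ X := fun x hx => by rw [hY]; simp [hx]
    by_contra! hsq
    have hnorot : ∀ a t, (r a, t) ∉ L := by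
      intro a t ha
      have h3 := hrot a t ha
      rw [AddSubgroup.mem_bot] at h3
      subst h3
      exact h0 t (hLX _ ha)
    have hLcard : L.card = numRefl (L.map Prod.fst) := by
      clear * - hnorot
      induction L using Multiset.induction with
      | empty => simp
      | cons x L ih =>
        have := ih fun a t ha => hnorot a t (Multiset.mem_cons_of_mem ha)
        rcases x with ⟨a | b, t⟩
        · exact absurd (Multiset.mem_cons_self _ _) (hnorot a t)
        · simp [this]; omega
    have hLabs : (L.card : ℤ) = |(svecSum U₀).2| := by
      rw [← abs_neg, ← hL2]
      by_cases hpos : ∃ a, (sr a, true) ∈ L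
      · obtain ⟨a, ha⟩ := hpos
        rw [svecSum_snd_eq_of_forall_pos, Nat.abs_cast, hLcard]
        intro b hb
        have h3 := hrefl a b ha hb
        rw [AddSubgroup.mem_bot, sub_eq_zero] at h3
        subst h3
        exact hsq a (hLX _ ha) (hLX _ hb)
      · push Not at hpos
        rw [svecSum_snd_eq_of_forall_neg hpos, abs_neg, Nat.abs_cast, hLcard]
    have hbig : s₁.card * max 2 L.card ≤ s₁.sum.card := by
      refine le_card_sum fun U hU => max_le (hcard U (by simp [hU])) ?_
      have h1 := hmin U (by simp [hU])
      have h2 := abs_svecSum_snd_le U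
      have h3 := numRefl_le_card (U.map Prod.fst)
      rw [Multiset.card_map] at h3
      omega
    have hZc := Multiset.card_le_card hsZ
    simp only [Multiset.card_add] at hZc
    have h5 : n * max 2 L.card ≤ s₁.card * max 2 L.card := Nat.mul_le_mul_right _ (by omega)
    generalize L.card = w at *
    rcases le_total w 3 with hw | hw
    · have : n * 2 ≤ n * max 2 w := Nat.mul_le_mul_left _ (le_max_left _ _)
      omega
    · rw [max_eq_right (by omega)] at *
      obtain ⟨w, rfl⟩ := Nat.exists_eq_add_of_le hw
      nlinarith

end Removal

section SmallAtoms

variable {G : Type*} [Group G]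

lemma sum_le_sum_of_le {α : Type*} {s t : Multiset (Multiset α)} (h : s ≤ t) : s.sum ≤ t.sum := by
  obtain ⟨u, rfl⟩ := Multiset.le_iff_exists_add.1 h
  rw [Multiset.sum_add]
  exact Multiset.le_add_right _ _

lemma IsProductOne.two_le_card {S : Multiset G} (hS : IsProductOne S) (h0 : S ≠ 0)
    (h1 : (1 : G) ∉ S) : 2 ≤ S.card := by
  by_contra! h
  have := Multiset.card_pos.2 h0
  obtain ⟨g, rfl⟩ := Multiset.card_eq_one.1 (show S.card = 1 by omega)
  obtain ⟨l, hl, hp⟩ := hS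
  rw [Multiset.coe_eq_singleton] at hl
  subst hl
  simp at hp h1
  exact h1 hp.symm

lemma isAtomSeq_pair {g h : G} (hgh : g * h = 1) (hg : g ≠ 1) (hh : h ≠ 1) :
    IsAtomSeq ({g, h} : Multiset G) := by
  refine ⟨by simp, ⟨[g, h], rfl, by simpa using hgh⟩, fun A B hAB hA hB => ?_⟩
  by_contra! hne
  have h1 : (1 : G) ∉ A + B := by rw [← hAB]; simp [hg.symm, hh.symm]
  rw [Multiset.mem_add, not_or] at h1
  have h2 := hA.two_le_card hne.1 h1.1
  have h3 := hB.two_le_card hne.2 h1.2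
  have := congrArg Multiset.card hAB
  simp at this
  omega

lemma IsAtomSeq.eq_singleton_one {U : Multiset G} (hU : IsAtomSeq U) (h : (1 : G) ∈ U) :
    U = {1} := by
  obtain ⟨l, rfl, hl⟩ := hU.2.1
  obtain ⟨s, t, rfl⟩ := List.append_of_mem (by simpa using h : (1 : G) ∈ l)
  have he : ((s ++ 1 :: t : List G) : Multiset G) = {1} + (s ++ t : List G) := by
    simp
  rcases hU.2.2 _ _ he ⟨[1], rfl, by simp⟩ ⟨_, rfl, by simpa using hl⟩ with h | h
  · simp at h
  · rw [he, h, add_zero]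

end SmallAtoms

section Phase

variable {n : ℕ}

lemma IsAtomSeq.card_le_of_rotations [NeZero n] {V : Multiset (DihedralGroup n)}
    (hV : IsAtomSeq V) (h : numRefl V = 0) : V.card ≤ n := by
  by_contra! hc
  obtain ⟨x, hx⟩ := Multiset.exists_mem_of_ne_zero hV.1
  obtain ⟨V, rfl⟩ := Multiset.exists_cons_of_mem hx
  rw [Multiset.card_cons] at hc
  obtain ⟨T, hT, hT0, hTs⟩ := exists_subseq_sum_eq_zero V coord (by rw [Nat.card_zmod]; omega)
  obtain ⟨W, rfl⟩ := Multiset.le_iff_exists_add.1 hT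
  have he : x ::ₘ (T + W) = T + x ::ₘ W := by simp
  rw [he] at hV h
  rw [numRefl_add] at h
  have hs := (isProductOne_iff_of_rotations (by rw [numRefl_add]; omega)).1 hV.2.1
  rw [Multiset.map_add, Multiset.sum_add, hTs, zero_add] at hs
  rcases hV.2.2 _ _ rfl ((isProductOne_iff_of_rotations (by omega)).2 hTs)
    ((isProductOne_iff_of_rotations (by omega)).2 hs) with h | h
  · exact hT0 h
  · simp at h

/-- A product-one sequence that contains many disjoint atoms is divisible by one of these atoms,
or by the square of a reflection. -/
lemma exists_dvd_of_many_atoms (hn : Odd n) {X : Multiset (DihedralGroup n)}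
    (hX : IsProductOne X) (h1 : (1 : DihedralGroup n) ∉ X)
    {s : Multiset (Multiset (DihedralGroup n))} (hs : s.sum ≤ X) (hat : ∀ U ∈ s, IsAtomSeq U)
    (hc : n + 1 ≤ s.card) :
    (∃ U ∈ s, ∃ W, X = U + W ∧ IsProductOne W) ∨
      (s.card < 2 * n - 1 ∧ ∃ b W, X = {sr b, sr b} + W ∧ IsProductOne W) := by
  have : NeZero n := ⟨by rintro rfl; simp at hn⟩
  by_cases hrefl : numRefl X = 0
  · left
    obtain ⟨U, hU⟩ := Multiset.card_pos_iff_exists_mem.1 (show 0 < s.card by omega)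
    obtain ⟨s, rfl⟩ := Multiset.exists_cons_of_mem hU
    obtain ⟨W, rfl⟩ := Multiset.le_iff_exists_add.1 hs
    rw [Multiset.sum_cons, add_assoc] at *
    rw [numRefl_add] at hrefl
    refine ⟨U, hU, _, rfl, (isProductOne_iff_of_rotations (by omega)).2 ?_⟩
    have h2 := (isProductOne_iff_of_rotations (by rw [numRefl_add]; omega)).1 hX
    have h3 := (isProductOne_iff_of_rotations (by omega)).1 (hat U hU).2.1
    rwa [Multiset.map_add, Multiset.sum_add, h3, zero_add] at h2
  obtain ⟨M, rfl, hM⟩ := hX.balanced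
  obtain ⟨t, ht, rfl⟩ := exists_family_of_sum_le_map hs
  rw [Multiset.card_map] at *
  have hat' : ∀ U ∈ t, IsAtomSeq (U.map Prod.fst) :=
    fun U hU => hat _ (Multiset.mem_map_of_mem _ hU)
  by_cases hrot : n ≤ (t.filter fun U => numRefl (U.map Prod.fst) = 0).card
  · left
    obtain ⟨T, hT, hT0, hTs⟩ := exists_subseq_sum_eq_zero _ (fun U => (svecSum U).1)
      (by rw [Nat.card_zmod]; exact hrot)
    have hTr : ∀ U ∈ T, numRefl (U.map Prod.fst) = 0 := fun U hU =>
      (Multiset.mem_filter.1 (Multiset.mem_of_le hT hU)).2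
    have hTt : T ≤ t := hT.trans (Multiset.filter_le _ _)
    obtain ⟨N, rfl⟩ := Multiset.le_iff_exists_add.1 ((sum_le_sum_of_le hTt).trans ht)
    have hnum : numRefl (T.sum.map Prod.fst) = 0 := by
      clear * - hTr
      induction T using Multiset.induction with
      | empty => simp
      | cons u T ih => simp [hTr u (by simp), ih fun v hv => hTr v (by simp [hv])]
    have hTsum : svecSum T.sum = 0 := by
      ext
      · rw [svecSum_sum_fst, hTs]; rfl
      · exact svecSum_sum_snd_eq_zero fun U hU => by
          have := abs_svecSum_snd_le U
          rw [hTr U hU] at this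
          simpa using this
    rw [svecSum_add, hTsum, zero_add] at hM
    have hN : IsProductOne (N.map Prod.fst) := by
      refine Balanced.isProductOne ⟨N, rfl, hM⟩ ?_
      rw [Multiset.map_add, numRefl_add] at hrefl
      omega
    obtain ⟨U, hU⟩ := Multiset.exists_mem_of_ne_zero hT0
    obtain ⟨T, rfl⟩ := Multiset.exists_cons_of_mem hU
    refine ⟨U.map Prod.fst, Multiset.mem_map_of_mem _ (Multiset.mem_of_le hTt hU),
      T.sum.map Prod.fst + N.map Prod.fst, by simp [add_assoc], IsProductOne.add ?_ hN⟩
    have : T.sum.map Prod.fst = (T.map (Multiset.map Prod.fst)).sum := by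
      clear * -
      induction T using Multiset.induction with
      | empty => simp
      | cons u T ih => simp [ih]
    rw [this]
    refine isProductOne_sum fun V hV => ?_
    obtain ⟨V', hV', rfl⟩ := Multiset.mem_map.1 hV
    exact (hat' V' (Multiset.mem_of_le hTt (Multiset.mem_cons_of_mem hV'))).2.1
  have hev : ∀ U ∈ t, 2 ∣ numRefl (U.map Prod.fst) := fun U hU =>
    (hat' U hU).2.1.balanced.even_numRefl
  have hnr : 2 ≤ (t.filter fun U => ¬numRefl (U.map Prod.fst) = 0).card := by
    have := congrArg Multiset.card
      (Multiset.filter_add_not (fun U => numRefl (U.map Prod.fst) = 0) t)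
    rw [Multiset.card_add] at this
    omega
  have hcard : ∀ U ∈ t, 2 ≤ U.card := by
    intro U hU
    have h2 := (hat' U hU).2.1.two_le_card (hat' U hU).1 fun h => h1 (by
      have h3 := Multiset.map_le_map (f := Prod.fst) ((Multiset.le_sum_of_mem hU).trans ht)
      exact Multiset.mem_of_le h3 h)
    simpa using h2
  have h0 : ∀ u, (r 0, u) ∉ M := fun u hu => h1 (Multiset.mem_map.2 ⟨_, hu, rfl⟩)
  rcases exists_removable hn hM ht hc hev hcard h0 with ⟨U, hU, W, rfl, hW⟩ | ⟨hlt, b, hb1, hb2⟩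
  · left
    refine ⟨U.map Prod.fst, Multiset.mem_map_of_mem _ hU, W.map Prod.fst, by simp,
      hW.isProductOne ?_⟩
    obtain ⟨t, rfl⟩ := Multiset.exists_cons_of_mem hU
    rw [Multiset.sum_cons, add_le_add_iff_left] at ht
    have h2 : 0 < (t.filter fun U => ¬numRefl (U.map Prod.fst) = 0).card := by
      rw [Multiset.filter_cons] at hnr
      split_ifs at hnr <;> simp at hnr ⊢ <;> omega
    obtain ⟨V, hV⟩ := Multiset.card_pos_iff_exists_mem.1 h2
    rw [Multiset.mem_filter] at hV
    have h3 := Multiset.map_le_map (f := Prod.fst) ((Multiset.le_sum_of_mem hV.1).trans ht)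
    have := numRefl_mono h3
    omega
  · right
    refine ⟨hlt, b, ?_⟩
    obtain ⟨N, rfl⟩ := Multiset.exists_cons_of_mem hb1
    obtain ⟨N, rfl⟩ := Multiset.exists_cons_of_mem
      (show (sr b, false) ∈ N by simpa using hb2)
    refine ⟨N.map Prod.fst, by simp, Balanced.isProductOne ⟨N, rfl, by simpa using hM⟩ ?_⟩
    have h4 : 4 ≤ numRefl (((sr b, true) ::ₘ (sr b, false) ::ₘ N).map Prod.fst) := by
      refine le_trans ?_ (numRefl_mono hs)
      obtain ⟨U, u, hUu⟩ : ∃ U u, (t.filter fun U => ¬numRefl (U.map Prod.fst) = 0) = U ::ₘ u := by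
        obtain ⟨U, hU⟩ := Multiset.card_pos_iff_exists_mem.1 (show 0 < Multiset.card _ by
          exact lt_of_lt_of_le (by norm_num) hnr)
        exact ⟨U, Multiset.exists_cons_of_mem hU⟩
      obtain ⟨V, v, rfl⟩ : ∃ V v, u = V ::ₘ v := by
        rw [hUu, Multiset.card_cons] at hnr
        obtain ⟨U, hU⟩ := Multiset.card_pos_iff_exists_mem.1 (show 0 < u.card by omega)
        exact ⟨U, Multiset.exists_cons_of_mem hU⟩
      have hle : U ::ₘ V ::ₘ v ≤ t := by rw [← hUu]; exact Multiset.filter_le _ _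
      have hU : U ∈ t.filter fun U => ¬numRefl (U.map Prod.fst) = 0 := by rw [hUu]; simp
      have hV : V ∈ t.filter fun U => ¬numRefl (U.map Prod.fst) = 0 := by rw [hUu]; simp
      rw [Multiset.mem_filter] at hU hV
      have e1 := hev U hU.1
      have e2 := hev V hV.1
      have := numRefl_mono (sum_le_sum_of_le (Multiset.map_le_map (f := Multiset.map Prod.fst) hle))
      simp only [Multiset.map_cons, Multiset.sum_cons, numRefl_add] at this
      omega
    simp at h4
    omega

end Phase

section Chains

variable {G : Type*}

lemma factDist_eq (z z' : Multiset (Multiset G)) :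
    factDist z z' = max (z - z').card (z' - z).card := by
  unfold factDist
  congr!

lemma factDist_comm (z z' : Multiset (Multiset G)) : factDist z z' = factDist z' z := by
  rw [factDist_eq, factDist_eq, max_comm]

lemma factDist_cons (U : Multiset G) (z z' : Multiset (Multiset G)) :
    factDist (U ::ₘ z) (U ::ₘ z') = factDist z z' := by
  rw [factDist_eq, factDist_eq]
  simp only [← Multiset.singleton_add, add_tsub_add_eq_tsub_left]

lemma factDist_le (z z' : Multiset (Multiset G)) : factDist z z' ≤ max z.card z'.card := by
  rw [factDist_eq]
  exact max_le_max (Multiset.card_le_card (Multiset.sub_le_self _ _))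
    (Multiset.card_le_card (Multiset.sub_le_self _ _))

variable [Group G]

/-- Two factorizations of `A` that can be joined by a chain with steps of length at most `N`. -/
def Conn (N : ℕ) (A : Multiset G) : Multiset (Multiset G) → Multiset (Multiset G) → Prop :=
  Relation.ReflTransGen
    fun x y => IsFactorization A x ∧ IsFactorization A y ∧ factDist x y ≤ N

lemma Conn.symm {N : ℕ} {A : Multiset G} {z z' : Multiset (Multiset G)} (h : Conn N A z z') :
    Conn N A z' z := by
  induction h with
  | refl => exact Relation.ReflTransGen.refl
  | tail _ hbc ih =>
    exact Relation.ReflTransGen.head ⟨hbc.2.1, hbc.1, by rw [factDist_comm]; exact hbc.2.2⟩ ih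

lemma Conn.trans {N : ℕ} {A : Multiset G} {x y z : Multiset (Multiset G)} (h : Conn N A x y)
    (h' : Conn N A y z) : Conn N A x z :=
  Relation.ReflTransGen.trans h h'

lemma Conn.cons {N : ℕ} {A U : Multiset G} (hU : IsAtomSeq U) {z z' : Multiset (Multiset G)}
    (h : Conn N A z z') : Conn N (U + A) (U ::ₘ z) (U ::ₘ z') := by
  induction h with
  | refl => exact Relation.ReflTransGen.refl
  | tail _ hbc ih =>
    refine ih.tail ⟨?_, ?_, by rw [factDist_cons]; exact hbc.2.2⟩
    · simpa using hU.isFactorization.add hbc.1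
    · simpa using hU.isFactorization.add hbc.2.1

lemma IsFactorization.exists_cons {A U : Multiset G} {z : Multiset (Multiset G)}
    (hz : IsFactorization A z) (hU : U ∈ z) :
    ∃ x B, z = U ::ₘ x ∧ A = U + B ∧ IsFactorization B x := by
  obtain ⟨x, rfl⟩ := Multiset.exists_cons_of_mem hU
  exact ⟨x, x.sum, rfl, by rw [← hz.2, Multiset.sum_cons],
    fun V hV => hz.1 V (Multiset.mem_cons_of_mem hV), rfl⟩

lemma conn_of_common {N : ℕ} {A U : Multiset G}
    (ih : ∀ B : Multiset G, B.card < A.card → ∀ z z', IsFactorization B z →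
      IsFactorization B z' → Conn N B z z') {z z' : Multiset (Multiset G)}
    (hz : IsFactorization A z) (hz' : IsFactorization A z') (hU : U ∈ z) (hU' : U ∈ z') :
    Conn N A z z' := by
  have hat := hz.1 U hU
  obtain ⟨x, B, rfl, rfl, hx⟩ := hz.exists_cons hU
  obtain ⟨y, C, rfl, hC, hy⟩ := hz'.exists_cons hU'
  rw [add_right_inj] at hC
  subst hC
  refine (ih B ?_ x y hx hy).cons hat
  have := Multiset.card_pos.2 hat.1
  rw [Multiset.card_add]
  omega

end Chains

section UpperBound

variable {n : ℕ}

/-- A factorization containing a short atom is linked to any long factorization, at the latest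
after passing to a factorization that contains the square of a reflection. -/
lemma conn_or_square (hn : Odd n) {N : ℕ} {A V : Multiset (DihedralGroup n)}
    (ih : ∀ B : Multiset (DihedralGroup n), B.card < A.card → ∀ z z', IsFactorization B z →
      IsFactorization B z' → Conn N B z z')
    (h1 : (1 : DihedralGroup n) ∉ A) {y z : Multiset (Multiset (DihedralGroup n))}
    (hy : IsFactorization A y) (hz : IsFactorization A z) (hV : V ∈ y)
    (hc : n + 1 + V.card ≤ z.card) :
    Conn N A y z ∨ (z.card < 2 * n - 1 + V.card ∧
      ∃ x b, IsFactorization A x ∧ {sr b, sr b} ∈ x ∧ Conn N A y x) := by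
  have hVat := hy.1 V hV
  obtain ⟨y', X, rfl, rfl, hy'⟩ := hy.exists_cons hV
  obtain ⟨t, htz, htc, htX⟩ := exists_subfamily_disjoint (s := z) (Z := V + X) (R := V) hz.2.le
    (Multiset.le_add_right _ _)
  rw [add_comm, add_le_add_iff_left] at htX
  have h1X : (1 : DihedralGroup n) ∉ X := fun h => h1 (by simp [h])
  rcases exists_dvd_of_many_atoms hn hy'.isProductOne h1X htX
    (fun U hU => hz.1 U (Multiset.mem_of_le htz hU)) (by omega) with
    ⟨U, hU, W, rfl, hW⟩ | ⟨hlt, b, W, rfl, hW⟩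
  · left
    obtain ⟨w, hw⟩ := hW.exists_isFactorization
    have hUz := Multiset.mem_of_le htz hU
    have hx := hVat.isFactorization.add ((hz.1 U hUz).isFactorization.add hw)
    exact (conn_of_common ih hy hx (U := V) (by simp) (by simp)).trans
      (conn_of_common ih hx hz (U := U) (by simp) hUz)
  · right
    obtain ⟨w, hw⟩ := hW.exists_isFactorization
    have hsq : IsAtomSeq ({sr b, sr b} : Multiset (DihedralGroup n)) :=
      isAtomSeq_pair (by simp) (by simp [one_def, -r_zero]) (by simp [one_def, -r_zero])
    have hx := hVat.isFactorization.add (hsq.isFactorization.add hw)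
    refine ⟨by omega, _, b, hx, by simp, conn_of_common ih hy hx (U := V) (by simp) (by simp)⟩

lemma exists_short_atom (h3 : 3 ≤ n) {N : ℕ} {A : Multiset (DihedralGroup n)}
    (ih : ∀ B : Multiset (DihedralGroup n), B.card < A.card → ∀ z z', IsFactorization B z →
      IsFactorization B z' → Conn N B z z')
    (hA : 4 * n + 1 ≤ A.card) {z : Multiset (Multiset (DihedralGroup n))}
    (hz : IsFactorization A z) :
    ∃ y V, IsFactorization A y ∧ Conn N A z y ∧ V ∈ y ∧ V.card ≤ n := by
  have : NeZero n := ⟨by omega⟩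
  have hlen : ∀ y, IsFactorization A y → 3 ≤ y.card := by
    intro y hy
    have h2 := card_sum_le (T := y) (c := 2 * n) fun U hU => by
      have := (hy.1 U hU).card_le
      rwa [DihedralGroup.card] at this
    rw [hy.2] at h2
    by_contra! h
    have : y.card * (2 * n) ≤ 2 * (2 * n) := Nat.mul_le_mul_right _ (by omega)
    omega
  have hex : ∃ a, ∃ y V, IsFactorization A y ∧ Conn N A z y ∧ V ∈ y ∧ V.card = a := by
    obtain ⟨V, hV⟩ := Multiset.card_pos_iff_exists_mem.1
      (show 0 < z.card by have := hlen z hz; omega)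
    exact ⟨_, z, V, hz, Relation.ReflTransGen.refl, hV, rfl⟩
  obtain ⟨y, V, hy, hzy, hV, hVc⟩ := Nat.find_spec hex
  have hmin : ∀ y' U, IsFactorization A y' → Conn N A z y' → U ∈ y' → Nat.find hex ≤ U.card :=
    fun y' U h1 h2 h3 => Nat.find_min' hex ⟨y', U, h1, h2, h3, rfl⟩
  refine ⟨y, V, hy, hzy, hV, ?_⟩
  by_contra! hbig
  have hVat := hy.1 V hV
  have hy3 := hlen y hy
  obtain ⟨y, rfl⟩ := Multiset.exists_cons_of_mem hV
  rw [Multiset.card_cons] at hy3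
  obtain ⟨V₂, hV₂⟩ := Multiset.card_pos_iff_exists_mem.1 (show 0 < y.card by omega)
  have hV₂at := hy.1 V₂ (by simp [hV₂])
  have hV₂c := hmin _ V₂ hy hzy (by simp [hV₂])
  obtain ⟨y, rfl⟩ := Multiset.exists_cons_of_mem hV₂
  rw [Multiset.card_cons] at hy3
  obtain ⟨V₃, hV₃⟩ := Multiset.card_pos_iff_exists_mem.1 (show 0 < y.card by omega)
  have hrefl : 0 < numRefl V₂ := by
    by_contra! h
    have := hV₂at.card_le_of_rotations (by omega)
    omega
  obtain ⟨b, hb⟩ := numRefl_pos_iff.1 hrefl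
  obtain ⟨V', W', hV', hW', hV0, he, hc⟩ := hVat.exchange (h := sr b)
    (by rw [DihedralGroup.card]; omega) (by simp) (by simp [one_def, -r_zero]) hV₂at.2.1 hb
  obtain ⟨v, hv⟩ := hV'.exists_isFactorization
  obtain ⟨w, hw⟩ := hW'.exists_isFactorization
  have hfac : IsFactorization A (v + w + y) := by
    have hrest : IsFactorization y.sum y := ⟨fun U hU => hy.1 U (by simp [hU]), rfl⟩
    have h5 := (hv.add hw).add hrest
    rw [← he] at h5
    rw [← hy.2, Multiset.sum_cons, Multiset.sum_cons, ← add_assoc]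
    exact h5
  have hconn : Conn N A z (v + w + y) :=
    hzy.trans (conn_of_common ih hy hfac (U := V₃) (by simp [hV₃]) (by simp [hV₃]))
  obtain ⟨U, hU⟩ : ∃ U, U ∈ v := by
    refine Multiset.exists_mem_of_ne_zero ?_
    rintro rfl
    exact hV0 (by simpa using hv.2.symm)
  have h6 := hmin _ U hfac hconn (by simp [hU])
  have h7 := Multiset.card_le_card (Multiset.le_sum_of_mem hU)
  rw [hv.2] at h7
  omega

lemma conn_of_card_lt (hn : Odd n) (h3 : 3 ≤ n) {A : Multiset (DihedralGroup n)}
    (ih : ∀ B : Multiset (DihedralGroup n), B.card < A.card → ∀ z z', IsFactorization B z →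
      IsFactorization B z' → Conn (2 * n) B z z') {z z' : Multiset (Multiset (DihedralGroup n))}
    (hz : IsFactorization A z) (hz' : IsFactorization A z') (hc : 2 * n < z.card) :
    Conn (2 * n) A z z' := by
  by_cases h1 : (1 : DihedralGroup n) ∈ A
  · have hmem : ∀ y, IsFactorization A y → ({1} : Multiset (DihedralGroup n)) ∈ y := by
      intro y hy
      rw [← hy.2] at h1
      obtain ⟨U, hU, hU1⟩ := Multiset.mem_join.1 h1
      rwa [← (hy.1 U hU).eq_singleton_one hU1]
    exact conn_of_common ih hz hz' (hmem z hz) (hmem z' hz')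
  have hA : z.card * 2 ≤ A.card := by
    rw [← hz.2]
    refine le_card_sum fun U hU => (hz.1 U hU).2.1.two_le_card (hz.1 U hU).1 fun h => h1 ?_
    rw [← hz.2]
    exact Multiset.mem_of_le (Multiset.le_sum_of_mem hU) h
  obtain ⟨y, V, hy, hzy, hV, hVc⟩ := exists_short_atom h3 ih (by omega) hz'
  refine Conn.symm (hzy.trans ?_)
  rcases conn_or_square hn ih h1 hy hz hV (by omega) with h | ⟨-, x, b, hx, hb, hyx⟩
  · exact h
  · refine hyx.trans ?_
    have h2 : ({sr b, sr b} : Multiset (DihedralGroup n)).card = 2 := by simp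
    rcases conn_or_square hn ih h1 hx hz hb (by omega) with h | ⟨h, -⟩
    · exact h
    · omega

lemma conn_of_isFactorization (hn : Odd n) (h3 : 3 ≤ n) (k : ℕ) :
    ∀ A : Multiset (DihedralGroup n), A.card = k → ∀ z z', IsFactorization A z →
      IsFactorization A z' → Conn (2 * n) A z z' := by
  induction k using Nat.strong_induction_on with
  | _ k ih =>
    rintro A rfl z z' hz hz'
    have ih' : ∀ B : Multiset (DihedralGroup n), B.card < A.card → ∀ z z', IsFactorization B z →
        IsFactorization B z' → Conn (2 * n) B z z' := fun B hB => ih _ hB B rfl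
    by_cases hc : 2 * n < z.card
    · exact conn_of_card_lt hn h3 ih' hz hz' hc
    by_cases hc' : 2 * n < z'.card
    · exact (conn_of_card_lt hn h3 ih' hz' hz hc').symm
    · exact Relation.ReflTransGen.single ⟨hz, hz', (factDist_le z z').trans (by simp; omega)⟩

lemma catenaryAt_le (hn : Odd n) (h3 : 3 ≤ n) (A : Multiset (DihedralGroup n)) :
    catenaryAt A ≤ ((2 * n : ℕ) : ℕ∞) := by
  refine sInf_le fun z z' hz hz' => ?_
  exact Relation.ReflTransGen.mono (fun x y h => ⟨h.2.1, by exact_mod_cast h.2.2⟩) z z'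
    (conn_of_isFactorization hn h3 _ A rfl z z' hz hz')

end UpperBound

section Catenary

variable {G : Type*}

lemma factDist_self (z : Multiset (Multiset G)) : factDist z z = 0 := by
  rw [factDist_eq]; simp

lemma factDist_of_disjoint {z z' : Multiset (Multiset G)} (h : ∀ U ∈ z, U ∉ z') :
    factDist z z' = max z.card z'.card := by
  rw [factDist_eq]
  have aux : ∀ z z' : Multiset (Multiset G), (∀ U ∈ z, U ∉ z') → z - z' = z := by
    intro z z' h
    ext U
    rw [Multiset.count_sub]
    by_cases hU : U ∈ z
    · rw [Multiset.count_eq_zero_of_notMem (h U hU), tsub_zero]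
    · rw [Multiset.count_eq_zero_of_notMem hU, zero_tsub]
  rw [aux z z' h, aux z' z fun U hU hU' => h U hU' hU]

variable [Group G]

lemma eq_of_factDist_le_one {A : Multiset G} {x y : Multiset (Multiset G)}
    (hx : IsFactorization A x) (hy : IsFactorization A y) (h : factDist x y ≤ 1) : x = y := by
  rw [factDist_eq, max_le_iff] at h
  have ex : x ∩ y + (x - y) = x := by
    rw [add_comm]; exact Multiset.sub_add_inter x y
  have ey : x ∩ y + (y - x) = y := by
    rw [add_comm, Multiset.inter_comm]; exact Multiset.sub_add_inter y x
  have hsum : (x - y).sum = (y - x).sum := by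
    have h1 : (x ∩ y + (x - y)).sum = (x ∩ y + (y - x)).sum := by rw [ex, ey, hx.2, hy.2]
    simpa using h1
  have hzero : ∀ w : Multiset (Multiset G), (∀ U ∈ w, IsAtomSeq U) → w.sum = 0 → w = 0 := by
    intro w hw h0
    refine Multiset.eq_zero_of_forall_notMem fun U hU => (hw U hU).1 ?_
    have := Multiset.le_sum_of_mem hU
    rw [h0] at this
    simpa using this
  have hax : ∀ U ∈ x - y, IsAtomSeq U := fun U hU =>
    hx.1 U (Multiset.mem_of_le (Multiset.sub_le_self _ _) hU)
  have hay : ∀ U ∈ y - x, IsAtomSeq U := fun U hU =>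
    hy.1 U (Multiset.mem_of_le (Multiset.sub_le_self _ _) hU)
  have key : x - y = y - x := by
    by_cases h1 : x - y = 0
    · rw [h1] at hsum ⊢
      exact (hzero _ hay (by simpa using hsum.symm)).symm
    by_cases h2 : y - x = 0
    · rw [h2] at hsum
      exact absurd (hzero _ hax (by simpa using hsum)) h1
    have c1 := Multiset.card_pos.2 h1
    have c2 := Multiset.card_pos.2 h2
    obtain ⟨U, hU⟩ := Multiset.card_eq_one.1 (le_antisymm h.1 c1)
    obtain ⟨V, hV⟩ := Multiset.card_eq_one.1 (le_antisymm h.2 c2)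
    rw [hU, hV] at hsum ⊢
    simpa using hsum
  calc x = x ∩ y + (x - y) := ex.symm
    _ = x ∩ y + (y - x) := by rw [key]
    _ = y := ey

lemma conn_catenaryAt (A : Multiset G) {z z' : Multiset (Multiset G)}
    (hz : IsFactorization A z) (hz' : IsFactorization A z') :
    Relation.ReflTransGen
      (fun x y => IsFactorization A y ∧ (factDist x y : ℕ∞) ≤ catenaryAt A) z z' :=
  csInf_mem (s := {N : ℕ∞ | ∀ z z' : Multiset (Multiset G),
    IsFactorization A z → IsFactorization A z' →
    Relation.ReflTransGen
      (fun x y => IsFactorization A y ∧ (factDist x y : ℕ∞) ≤ N) z z'})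
    ⟨⊤, fun _ _ _ h' => Relation.ReflTransGen.single ⟨h', le_top⟩⟩ z z' hz hz'

lemma eq_of_catenaryAt_lt_two {A : Multiset G} (h : catenaryAt A < 2)
    {z z' : Multiset (Multiset G)} (hz : IsFactorization A z) (hz' : IsFactorization A z') :
    z = z' := by
  have hchain := conn_catenaryAt A hz hz'
  clear hz'
  induction hchain with
  | refl => rfl
  | tail _ hbc ih =>
    rename_i b c hab
    subst ih
    refine eq_of_factDist_le_one hz hbc.1 ?_
    have h1 := lt_of_le_of_lt hbc.2 h
    have h2 : factDist z c < 2 := by exact_mod_cast h1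
    omega

lemma two_le_catenaryAt {A : Multiset G} (h : 0 < catenaryAt A) : 2 ≤ catenaryAt A := by
  by_contra! hlt
  refine absurd h (not_lt.2 (sInf_le fun z z' hz hz' => ?_))
  rw [eq_of_catenaryAt_lt_two hlt hz hz']

lemma catenaryAt_le_of_forall {A : Multiset G} {k : ℕ}
    (h : ∀ z z', IsFactorization A z → IsFactorization A z' → factDist z z' ≤ k) :
    catenaryAt A ≤ k :=
  sInf_le fun z z' hz hz' =>
    Relation.ReflTransGen.single ⟨hz', by exact_mod_cast h z z' hz hz'⟩

lemma catenaryAt_eq_of_two {A : Multiset G} {z₁ z₂ : Multiset (Multiset G)} {k : ℕ} (hk : 0 < k)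
    (h₁ : IsFactorization A z₁) (h₂ : IsFactorization A z₂)
    (h : ∀ y, IsFactorization A y → y = z₁ ∨ y = z₂) (hd : factDist z₁ z₂ = k) :
    catenaryAt A = k := by
  have hne : z₁ ≠ z₂ := by
    rintro rfl
    rw [factDist_self] at hd
    omega
  refine le_antisymm (catenaryAt_le_of_forall fun z z' hz hz' => ?_) ?_
  · rcases h z hz with rfl | rfl <;> rcases h z' hz' with rfl | rfl
    · simp [factDist_self]
    · exact hd.le
    · rw [factDist_comm]; exact hd.le
    · simp [factDist_self]
  · by_contra! hlt
    have hstay : ∀ y, Relation.ReflTransGen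
        (fun x y => IsFactorization A y ∧ (factDist x y : ℕ∞) ≤ catenaryAt A) z₁ y → y = z₁ := by
      intro y hy
      induction hy with
      | refl => rfl
      | tail _ hbc ih =>
        subst ih
        rcases h _ hbc.1 with h3 | h3
        · exact h3
        · rw [h3, hd] at hbc
          exact absurd hbc.2 (not_le.2 hlt)
    exact hne (hstay _ (conn_catenaryAt A h₁ h₂)).symm

end Catenary

section CatenaryTwo

variable {n : ℕ}

lemma exists_catenaryAt_eq_two (h3 : 3 ≤ n) :
    ∃ A : Multiset (DihedralGroup n), IsProductOne A ∧ catenaryAt A = 2 := by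
  have h1 : (1 : ZMod n) ≠ 0 := by
    intro h
    have := (ZMod.natCast_eq_zero_iff 1 n).1 (by simpa using h)
    have := Nat.le_of_dvd (by norm_num) this
    omega
  have h2 : (1 + 1 : ZMod n) ≠ 0 := by
    intro h
    have := (ZMod.natCast_eq_zero_iff 2 n).1 (by rw [← h]; norm_num)
    have := Nat.le_of_dvd (by norm_num) this
    omega
  have h20 : (2 : ZMod n) ≠ 1 := by
    intro h
    exact h1 (by linear_combination h)
  set B : Multiset (DihedralGroup n) := {sr 0, r 1, sr 1} with hB
  set C : Multiset (DihedralGroup n) := {sr 1, r 1, sr 2} with hC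
  set D : Multiset (DihedralGroup n) := {sr 1, sr 1} with hD
  set E : Multiset (DihedralGroup n) := {sr 0, r 1, r 1, sr 2} with hE
  have hBp : IsProductOne B := ⟨[sr 0, r 1, sr 1], rfl, by simp⟩
  have hCp : IsProductOne C := ⟨[sr 1, r 1, sr 2], rfl, by simp; norm_num⟩
  have hEp : IsProductOne E := ⟨[sr 0, r 1, r 1, sr 2], rfl, by simp; norm_num⟩
  have hDa : IsAtomSeq D :=
    isAtomSeq_pair (by simp) (by simp [one_def, -r_zero]) (by simp [one_def, -r_zero])
  have hsum : D + E = B + C := by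
    simp only [hB, hC, hD, hE, Multiset.insert_eq_cons, ← Multiset.singleton_add]
    abel
  have hle : ∀ z, IsFactorization (B + C) z → z.card ≤ 2 := by
    intro z hz
    have hrefl : ∀ U ∈ z, 2 ≤ numRefl U := by
      intro U hU
      have hat := hz.1 U hU
      have hev := hat.2.1.balanced.even_numRefl
      by_contra! hlt
      have h0 : numRefl U = 0 := by omega
      have hUle : U ≤ B + C := by rw [← hz.2]; exact Multiset.le_sum_of_mem hU
      have hr : ∀ g ∈ U, g = r 1 := by
        intro g hg
        have e1 := reflInd_eq_zero_of_numRefl h0 hg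
        have e2 := Multiset.mem_of_le hUle hg
        simp [hB, hC] at e2
        rcases e2 with rfl | rfl | rfl | rfl | rfl | rfl <;> simp_all
      rw [← Multiset.eq_replicate_card] at hr
      have hcount := Multiset.le_iff_count.1 hUle (r 1)
      rw [hr, Multiset.count_replicate_self] at hcount
      have hBC : (B + C).count (r 1) = 2 := by
        simp [hB, hC, Multiset.insert_eq_cons]
      rw [hBC] at hcount
      have hs := (isProductOne_iff_of_rotations h0).1 hat.2.1
      have hpos := Multiset.card_pos.2 hat.1
      rw [hr] at hs
      interval_cases Multiset.card U
      · simp at hs; exact h1 hs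
      · simp [Multiset.replicate_succ] at hs; exact h2 hs
    have hmul : z.card * 2 ≤ numRefl z.sum := by
      clear * - hrefl
      induction z using Multiset.induction with
      | empty => simp
      | cons U z ih =>
        have a1 := hrefl U (by simp)
        have a2 := ih fun V hV => hrefl V (by simp [hV])
        simp
        omega
    rw [hz.2] at hmul
    simp [hB, hC, Multiset.insert_eq_cons] at hmul
    omega
  refine ⟨B + C, hBp.add hCp, le_antisymm ?_ ?_⟩
  · exact catenaryAt_le_of_forall (k := 2) fun z z' hz hz' => (factDist_le z z').trans
      (max_le (hle z hz) (hle z' hz'))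
  · by_contra! hlt
    obtain ⟨b, hb⟩ := hBp.exists_isFactorization
    obtain ⟨c, hc⟩ := hCp.exists_isFactorization
    obtain ⟨e, he⟩ := hEp.exists_isFactorization
    have hz := hb.add hc
    have hz' := hDa.isFactorization.add he
    rw [hsum] at hz'
    have heq := eq_of_catenaryAt_lt_two hlt hz hz'
    have hmem : D ∈ b + c := by rw [heq]; simp
    have hcount : ∀ w S, IsFactorization S w → D ∈ w → 2 ≤ S.count (sr 1) := by
      rintro w S hw hDw
      rw [← hw.2]
      refine le_trans ?_ (Multiset.le_iff_count.1 (Multiset.le_sum_of_mem hDw) (sr 1))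
      simp [hD, Multiset.insert_eq_cons]
    rcases Multiset.mem_add.1 hmem with h | h
    · have := hcount _ _ hb h
      simp [hB, Multiset.insert_eq_cons, h1] at this
    · have := hcount _ _ hc h
      simp [hC, Multiset.insert_eq_cons, h20.symm] at this

end CatenaryTwo

section PairSeq

variable {n : ℕ}

/-- The sequence consisting of `x` copies of `sr 0` and `y` copies of `sr 1`. -/
def pairSeq (n x y : ℕ) : Multiset (DihedralGroup n) :=
  Multiset.replicate x (sr 0) + Multiset.replicate y (sr 1)

lemma pairSeq_add (x y x' y' : ℕ) :
    pairSeq n x y + pairSeq n x' y' = pairSeq n (x + x') (y + y') := by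
  simp only [pairSeq, Multiset.replicate_add]
  abel

@[simp] lemma pairSeq_zero : pairSeq n 0 0 = 0 := by simp [pairSeq]

@[simp] lemma numRefl_pairSeq (x y : ℕ) : numRefl (pairSeq n x y) = x + y := by
  simp [pairSeq, numRefl]

lemma pairSeq_eq_zero {x y : ℕ} (h : pairSeq n x y = 0) : x = 0 ∧ y = 0 := by
  have := congrArg numRefl h
  simpa using this

lemma eq_or_eq_of_mem_pairSeq {g : DihedralGroup n} {x y : ℕ} (h : g ∈ pairSeq n x y) :
    g = sr 0 ∨ g = sr 1 := by
  rcases Multiset.mem_add.1 h with h | h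
  · exact Or.inl (Multiset.eq_of_mem_replicate h)
  · exact Or.inr (Multiset.eq_of_mem_replicate h)

lemma sr_zero_ne_sr_one (h1 : 1 < n) : (sr 0 : DihedralGroup n) ≠ sr 1 := by
  have : Fact (1 < n) := ⟨h1⟩
  simp

lemma pairSeq_injective (h1 : 1 < n) {x y x' y' : ℕ} (h : pairSeq n x y = pairSeq n x' y') :
    x = x' ∧ y = y' := by
  have hne := sr_zero_ne_sr_one h1
  have e0 := congrArg (Multiset.count (sr 0)) h
  have e1 := congrArg (Multiset.count (sr 1)) h
  simp only [pairSeq, Multiset.count_add, Multiset.count_replicate] at e0 e1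
  simp [hne, hne.symm] at e0 e1
  exact ⟨e0, e1⟩

lemma exists_eq_pairSeq {S : Multiset (DihedralGroup n)} (h : ∀ g ∈ S, g = sr 0 ∨ g = sr 1) :
    ∃ x y, S = pairSeq n x y := by
  induction S using Multiset.induction with
  | empty => exact ⟨0, 0, by simp⟩
  | cons g S ih =>
    obtain ⟨x, y, rfl⟩ := ih fun g hg => h g (by simp [hg])
    rcases h g (by simp) with rfl | rfl
    · exact ⟨x + 1, y, by simp [pairSeq, Multiset.replicate_succ]⟩
    · exact ⟨x, y + 1, by simp [pairSeq, Multiset.replicate_succ]⟩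

/-- A decomposition of `pairSeq a b` into two sequences comes from decompositions of
`a` and `b`. -/
lemma exists_of_add_eq_pairSeq (h1 : 1 < n) {S T : Multiset (DihedralGroup n)} {a b : ℕ}
    (h : S + T = pairSeq n a b) :
    ∃ x y x' y', S = pairSeq n x y ∧ T = pairSeq n x' y' ∧ x + x' = a ∧ y + y' = b := by
  have hmem : ∀ g ∈ S + T, g = sr 0 ∨ g = sr 1 := fun g hg =>
    eq_or_eq_of_mem_pairSeq (h ▸ hg)
  obtain ⟨x, y, rfl⟩ := exists_eq_pairSeq fun g hg => hmem g (Multiset.mem_add.2 (Or.inl hg))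
  obtain ⟨x', y', rfl⟩ := exists_eq_pairSeq fun g hg => hmem g (Multiset.mem_add.2 (Or.inr hg))
  rw [pairSeq_add] at h
  exact ⟨x, y, x', y', rfl, rfl, pairSeq_injective h1 h⟩

lemma svecSum_replicate (k : ℕ) (x : DihedralGroup n × Bool) :
    svecSum (Multiset.replicate k x) = k • svec x := by
  simp [svecSum]

lemma exists_svecSum_eq_of_map_eq_replicate {M : Multiset (DihedralGroup n × Bool)} {x : ℕ}
    {g : DihedralGroup n} (h : M.map Prod.fst = Multiset.replicate x g) :
    ∃ p : ℤ, |p| ≤ x ∧ (2 : ℤ) ∣ p - x ∧ svecSum M = p • vec g := by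
  induction x generalizing M with
  | zero =>
    have : M = 0 := by simpa using h
    exact ⟨0, by simp, by simp, by simp [this]⟩
  | succ x ih =>
    rw [Multiset.replicate_succ] at h
    obtain ⟨⟨g', s⟩, hm, hg⟩ := Multiset.mem_map.1 (h.symm ▸ Multiset.mem_cons_self g _)
    obtain ⟨N, rfl⟩ := Multiset.exists_cons_of_mem hm
    obtain rfl : g' = g := hg
    obtain ⟨p, hp, hp2, hs⟩ := ih (M := N) (by simpa using h)
    rw [abs_le] at hp
    cases s
    · refine ⟨p - 1, abs_le.2 ⟨?_, ?_⟩, ?_, ?_⟩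
      · push_cast; linarith
      · push_cast; linarith
      · push_cast; omega
      · rw [svecSum_cons, hs, svec_false, sub_smul, one_smul]; abel
    · refine ⟨p + 1, abs_le.2 ⟨?_, ?_⟩, ?_, ?_⟩
      · push_cast; linarith
      · push_cast; linarith
      · push_cast; omega
      · rw [svecSum_cons, hs, svec_true, add_smul, one_smul]; abel

/-- The numerical data behind a balanced sequence `pairSeq x y + T`. -/
lemma Balanced.exists_of_pairSeq_add {x y : ℕ} {T : Multiset (DihedralGroup n)}
    (h : Balanced (pairSeq n x y + T)) :
    ∃ (p q : ℤ) (N : Multiset (DihedralGroup n × Bool)), N.map Prod.fst = T ∧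
      |p| ≤ x ∧ (2 : ℤ) ∣ p - x ∧ |q| ≤ y ∧ (2 : ℤ) ∣ q - y ∧
      (q : ZMod n) + (svecSum N).1 = 0 ∧ p + q + (svecSum N).2 = 0 := by
  obtain ⟨M, hM, h0⟩ := h
  obtain ⟨V, N, rfl, hV, hN⟩ := exists_add_of_map_eq_add hM
  obtain ⟨X, Y, rfl, hX, hY⟩ := exists_add_of_map_eq_add hV
  obtain ⟨p, hp, hp2, hps⟩ := exists_svecSum_eq_of_map_eq_replicate hX
  obtain ⟨q, hq, hq2, hqs⟩ := exists_svecSum_eq_of_map_eq_replicate hY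
  rw [svecSum_add, svecSum_add, hps, hqs] at h0
  refine ⟨p, q, N, hN, hp, hp2, hq, hq2, ?_, ?_⟩
  · simpa using congrArg Prod.fst h0
  · simpa using congrArg Prod.snd h0

lemma isProductOne_pairSeq_even (x y : ℕ) : IsProductOne (pairSeq n (2 * x) (2 * y)) := by
  have h : ∀ (x : ℕ) (b : ZMod n), IsProductOne (Multiset.replicate (2 * x) (sr b)) := by
    intro x b
    refine ⟨List.replicate (2 * x) (sr b), Multiset.coe_replicate _ _, ?_⟩
    rw [List.prod_replicate, pow_mul, pow_two, sr_mul_self, one_pow]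
  exact (h x 0).add (h y 1)

lemma isProductOne_pairSeq_self (h0 : 0 < n) : IsProductOne (pairSeq n n n) := by
  refine Balanced.isProductOne ⟨Multiset.replicate n (sr 0, true) +
    Multiset.replicate n (sr 1, false), by simp [pairSeq], ?_⟩ (by simpa using h0)
  rw [svecSum_add, svecSum_replicate, svecSum_replicate]
  ext <;> simp

lemma two_mul_le_mul_or {w t : ℤ} (hw : w = n * t) :
    w = 0 ∨ (n ≤ w ∧ (t = 1 ∨ 2 * n ≤ w)) ∨ (w ≤ -n ∧ (t = -1 ∨ w ≤ -(2 * n))) := by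
  rcases lt_trichotomy t 0 with h | h | h
  · right; right
    rcases eq_or_ne t (-1) with rfl | h'
    · exact ⟨by rw [hw]; linarith, Or.inl rfl⟩
    · have : t ≤ -2 := by omega
      exact ⟨by rw [hw]; nlinarith, Or.inr (by rw [hw]; nlinarith)⟩
  · left; simp [hw, h]
  · right; left
    rcases eq_or_ne t 1 with rfl | h'
    · exact ⟨by rw [hw]; linarith, Or.inl rfl⟩
    · have : 2 ≤ t := by omega
      exact ⟨by rw [hw]; nlinarith, Or.inr (by rw [hw]; nlinarith)⟩

lemma IsProductOne.pairSeq_cases {x y : ℕ} (h : IsProductOne (pairSeq n x y)) :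
    (2 ∣ x ∧ 2 ∣ y) ∨ (n ≤ x ∧ n ≤ y ∧ ¬ 2 ∣ x ∧ ¬ 2 ∣ y) := by
  have hb := h.balanced
  rw [← add_zero (pairSeq n x y)] at hb
  obtain ⟨p, q, N, hN, hp, hp2, hq, hq2, e1, e2⟩ := hb.exists_of_pairSeq_add
  obtain rfl : N = 0 := by simpa using hN
  simp only [svecSum_zero, Prod.fst_zero, Prod.snd_zero, add_zero] at e1 e2
  obtain ⟨t, ht⟩ := (ZMod.intCast_zmod_eq_zero_iff_dvd q n).1 e1
  rw [abs_le] at hp hq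
  rcases two_mul_le_mul_or ht with h | h | h <;> omega

/-- The possible shapes of a product-one sequence `pairSeq x y + {e}`. -/
lemma IsProductOne.pairSeq_add_cases (hn : Odd n) {e : DihedralGroup n} {m : ℕ}
    (he : coord e = m) (hm : m < n) (hd : reflInd e < m) {x y : ℕ}
    (h : IsProductOne (pairSeq n x y + {e})) :
    (m ≤ y ∧ m ≤ x + reflInd e ∧ 2 ∣ y + m ∧ 2 ∣ x + reflInd e + m) ∨
      (n ≤ y + m ∧ n + reflInd e ≤ x + m ∧ ¬ 2 ∣ y + m ∧ ¬ 2 ∣ x + reflInd e + m) := by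
  obtain ⟨p, q, N, hN, hp, hp2, hq, hq2, e1, e2⟩ := h.balanced.exists_of_pairSeq_add
  obtain ⟨⟨g, s⟩, rfl, rfl⟩ := Multiset.map_eq_singleton.1 hN
  have hle := reflInd_le_one g
  rw [abs_le] at hp hq
  rw [svecSum_singleton] at e1 e2
  obtain ⟨k, hk⟩ := hn
  have hpar : ∀ w t : ℤ, w = n * t → (2 ∣ w ↔ 2 ∣ t) := by
    rintro w t rfl
    rw [hk, Int.prime_two.dvd_mul]
    push_cast
    omega
  cases s
  · simp only [svec_false, Prod.fst_neg, Prod.snd_neg, vec_fst, vec_snd] at e1 e2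
    simp only at he
    rw [he] at e1
    obtain ⟨t, ht⟩ := (ZMod.intCast_zmod_eq_zero_iff_dvd (q - m) n).1
      (by push_cast; linear_combination e1)
    have h1 := hpar _ _ ht
    have h2 := two_mul_le_mul_or ht
    simp only at hd ⊢
    omega
  · simp only [svec_true, vec_fst, vec_snd] at e1 e2
    simp only at he
    rw [he] at e1
    obtain ⟨t, ht⟩ := (ZMod.intCast_zmod_eq_zero_iff_dvd (q + m) n).1
      (by push_cast; linear_combination e1)
    have h1 := hpar _ _ ht
    have h2 := two_mul_le_mul_or ht
    simp only at hd ⊢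
    omega

end PairSeq

section Realization

variable {n : ℕ}

lemma IsAtomSeq.eq_singleton_of_isFactorization {G : Type*} [Group G] {U : Multiset G}
    {z : Multiset (Multiset G)} (hU : IsAtomSeq U) (hz : IsFactorization U z) : z = {U} := by
  obtain ⟨V, hV⟩ := Multiset.exists_mem_of_ne_zero (s := z)
    (by rintro rfl; exact hU.1 (by simpa using hz.2.symm))
  obtain ⟨x, B, rfl, rfl, hx⟩ := hz.exists_cons hV
  have hVa := hz.1 V hV
  rcases hU.2.2 V B rfl hVa.2.1 hx.isProductOne with h | rfl
  · exact absurd h hVa.1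
  · have : x = 0 := by
      refine Multiset.eq_zero_of_forall_notMem fun W hW => (hx.1 W hW).1 ?_
      have := Multiset.le_sum_of_mem hW
      rw [hx.2] at this
      simpa using this
    simp [this]

lemma isAtomSeq_pairSeq_two_zero (n : ℕ) : IsAtomSeq (pairSeq n 2 0) := by
  have h : pairSeq n 2 0 = {sr 0, sr 0} := by simp [pairSeq, Multiset.replicate_succ]
  rw [h]
  exact isAtomSeq_pair (by simp) (by simp [one_def, -r_zero]) (by simp [one_def, -r_zero])

lemma isAtomSeq_pairSeq_zero_two (n : ℕ) : IsAtomSeq (pairSeq n 0 2) := by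
  have h : pairSeq n 0 2 = {sr 1, sr 1} := by simp [pairSeq, Multiset.replicate_succ]
  rw [h]
  exact isAtomSeq_pair (by simp) (by simp [one_def, -r_zero]) (by simp [one_def, -r_zero])

lemma isAtomSeq_pairSeq_self (hn : Odd n) (h1 : 1 < n) : IsAtomSeq (pairSeq n n n) := by
  obtain ⟨k, hk⟩ := hn
  refine ⟨fun h => ?_, isProductOne_pairSeq_self (by omega), fun A B h hA hB => ?_⟩
  · have := pairSeq_eq_zero h
    omega
  · obtain ⟨x, y, x', y', rfl, rfl, hx, hy⟩ := exists_of_add_eq_pairSeq h1 h.symm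
    have c1 := hA.pairSeq_cases
    have c2 := hB.pairSeq_cases
    have h3 : (x = 0 ∧ y = 0) ∨ (x' = 0 ∧ y' = 0) := by omega
    rcases h3 with ⟨rfl, rfl⟩ | ⟨rfl, rfl⟩ <;> simp

lemma IsAtomSeq.pairSeq_cases (hn : Odd n) {x y : ℕ} (h : IsAtomSeq (pairSeq n x y)) :
    pairSeq n x y = pairSeq n n n ∨ pairSeq n x y = pairSeq n 2 0 ∨
      pairSeq n x y = pairSeq n 0 2 := by
  have split : ∀ a b c d, a + 2 * c = x → b + 2 * d = y → IsProductOne (pairSeq n a b) →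
      0 < a + b → pairSeq n x y = pairSeq n a b := by
    rintro a b c d rfl rfl hab hpos
    rcases h.2.2 (pairSeq n a b) (pairSeq n (2 * c) (2 * d)) (pairSeq_add _ _ _ _).symm hab
      (isProductOne_pairSeq_even c d) with h0 | h0
    · have := pairSeq_eq_zero h0
      omega
    · rw [← pairSeq_add, h0, add_zero]
  rcases h.2.1.pairSeq_cases with ⟨⟨c, rfl⟩, ⟨d, rfl⟩⟩ | ⟨h1, h2, h3, h4⟩
  · rcases Nat.eq_zero_or_pos c with rfl | hc
    · rcases Nat.eq_zero_or_pos d with rfl | hd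
      · exact absurd pairSeq_zero h.1
      · exact Or.inr (Or.inr (split 0 2 0 (d - 1) (by omega) (by omega)
          (isAtomSeq_pairSeq_zero_two n).2.1 (by omega)))
    · exact Or.inr (Or.inl (split 2 0 (c - 1) d (by omega) (by omega)
        (isAtomSeq_pairSeq_two_zero n).2.1 (by omega)))
  · obtain ⟨k, hk⟩ := hn
    exact Or.inl (split n n ((x - n) / 2) ((y - n) / 2) (by omega) (by omega)
      (isProductOne_pairSeq_self (by omega)) (by omega))

/-- The factorization of a sequence over `{sr 0, sr 1}` with prescribed multiplicities of the
three atoms. -/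
def pairFact (n i j k : ℕ) : Multiset (Multiset (DihedralGroup n)) :=
  Multiset.replicate i (pairSeq n n n) + Multiset.replicate j (pairSeq n 2 0) +
    Multiset.replicate k (pairSeq n 0 2)

lemma isFactorization_pairFact (hn : Odd n) (h1 : 1 < n) (i j k : ℕ) :
    IsFactorization (pairSeq n (n * i + 2 * j) (n * i + 2 * k)) (pairFact n i j k) := by
  constructor
  · intro U hU
    simp only [pairFact, Multiset.mem_add] at hU
    rcases hU with (hU | hU) | hU
    · rw [Multiset.eq_of_mem_replicate hU]; exact isAtomSeq_pairSeq_self hn h1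
    · rw [Multiset.eq_of_mem_replicate hU]; exact isAtomSeq_pairSeq_two_zero n
    · rw [Multiset.eq_of_mem_replicate hU]; exact isAtomSeq_pairSeq_zero_two n
  · have hs : ∀ c x y : ℕ, c • pairSeq n x y = pairSeq n (x * c) (y * c) := by
      intro c x y
      simp [pairSeq, Multiset.nsmul_replicate, mul_comm]
    simp [pairFact, hs, pairSeq_add]

lemma IsFactorization.exists_eq_pairFact (hn : Odd n) (h1 : 1 < n) {a b : ℕ}
    {z : Multiset (Multiset (DihedralGroup n))} (hz : IsFactorization (pairSeq n a b) z) :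
    ∃ i j k, z = pairFact n i j k ∧ n * i + 2 * j = a ∧ n * i + 2 * k = b := by
  have hcases : ∀ U ∈ z, U = pairSeq n n n ∨ U = pairSeq n 2 0 ∨ U = pairSeq n 0 2 := by
    intro U hU
    obtain ⟨x, B, -, hB, -⟩ := hz.exists_cons hU
    obtain ⟨x, y, -, -, rfl, -⟩ := exists_of_add_eq_pairSeq h1 hB.symm
    exact (hz.1 _ hU).pairSeq_cases hn
  have hform : ∃ i j k, z = pairFact n i j k := by
    clear hz
    induction z using Multiset.induction with
    | empty => exact ⟨0, 0, 0, by simp [pairFact]⟩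
    | cons U z ih =>
      obtain ⟨i, j, k, rfl⟩ := ih fun V hV => hcases V (by simp [hV])
      rcases hcases U (by simp) with rfl | rfl | rfl
      · exact ⟨i + 1, j, k, by simp [pairFact, Multiset.replicate_succ]⟩
      · exact ⟨i, j + 1, k, by simp [pairFact, Multiset.replicate_succ]⟩
      · exact ⟨i, j, k + 1, by simp [pairFact, Multiset.replicate_succ]⟩
  obtain ⟨i, j, k, rfl⟩ := hform
  have h2 := (isFactorization_pairFact hn h1 i j k).2
  rw [hz.2] at h2
  obtain ⟨h3, h4⟩ := pairSeq_injective h1 h2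
  exact ⟨i, j, k, rfl, h3.symm, h4.symm⟩

lemma exists_catenaryAt_eq_two_mul (hn : Odd n) (h3 : 3 ≤ n) :
    ∃ A : Multiset (DihedralGroup n), IsProductOne A ∧ catenaryAt A = ((2 * n : ℕ) : ℕ∞) := by
  have h1 : 1 < n := by omega
  have f₁ := isFactorization_pairFact hn h1 2 0 0
  have f₂ := isFactorization_pairFact hn h1 0 n n
  have e1 : n * 2 + 2 * 0 = 2 * n := by ring
  have e2 : n * 0 + 2 * n = 2 * n := by ring
  rw [e1] at f₁
  rw [e2] at f₂
  refine ⟨_, isProductOne_pairSeq_even n n, catenaryAt_eq_of_two (by omega) f₁ f₂ ?_ ?_⟩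
  · intro y hy
    obtain ⟨i, j, k, rfl, hj, hk⟩ := hy.exists_eq_pairFact hn h1
    obtain ⟨l, hl⟩ := hn
    have hi : i ≤ 2 := by
      by_contra! hi
      nlinarith
    interval_cases i
    · obtain rfl : j = n := by omega
      obtain rfl : k = j := by omega
      exact Or.inr rfl
    · omega
    · obtain rfl : j = 0 := by omega
      obtain rfl : k = 0 := by omega
      exact Or.inl rfl
  · rw [factDist_of_disjoint]
    · simp [pairFact]
      omega
    · intro U hU hU'
      obtain rfl : U = pairSeq n n n := by simpa [pairFact] using hU
      simp only [pairFact, Multiset.replicate_zero, zero_add, Multiset.mem_add] at hU'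
      rcases hU' with hU' | hU'
      · have := pairSeq_injective h1 (Multiset.eq_of_mem_replicate hU')
        omega
      · have := pairSeq_injective h1 (Multiset.eq_of_mem_replicate hU')
        omega

lemma notMem_pairSeq {e : DihedralGroup n} {m : ℕ} (he : coord e = m) (hm : m < n)
    (hd : reflInd e < m) (x y : ℕ) : e ∉ pairSeq n x y := by
  have hinj : ∀ k < n, (m : ZMod n) = (k : ℕ) → m = k := by
    intro k hk h
    have := (ZMod.natCast_eq_natCast_iff' m k n).1 h
    rwa [Nat.mod_eq_of_lt hm, Nat.mod_eq_of_lt hk] at this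
  intro h
  rcases eq_or_eq_of_mem_pairSeq h with rfl | rfl
  · have := hinj 0 (by omega) (by rw [← he]; simp)
    omega
  · have hd' : 1 < m := hd
    have := hinj 1 (by omega) (by rw [← he]; simp)
    omega

/-- A decomposition of `pairSeq a b + {e}` into two sequences, the first of which contains
`e`. -/
lemma exists_of_add_eq_pairSeq_add (h1 : 1 < n) {e : DihedralGroup n}
    {S T : Multiset (DihedralGroup n)} {a b : ℕ} (h : S + T = pairSeq n a b + {e}) (heS : e ∈ S) :
    ∃ x y x' y', S = pairSeq n x y + {e} ∧ T = pairSeq n x' y' ∧ x + x' = a ∧ y + y' = b := by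
  obtain ⟨R, rfl⟩ := Multiset.exists_cons_of_mem heS
  rw [Multiset.cons_add, ← Multiset.singleton_add, add_comm (pairSeq n a b)] at h
  obtain ⟨x, y, x', y', rfl, hT, hx, hy⟩ := exists_of_add_eq_pairSeq h1 (add_left_cancel h)
  exact ⟨x, y, x', y', by rw [← Multiset.singleton_add, add_comm], hT, hx, hy⟩

section Distinguished

variable {e : DihedralGroup n} {m : ℕ}

lemma isProductOne_pairSeq_add_small (he : coord e = m) (hd : reflInd e < m) :
    IsProductOne (pairSeq n (m - reflInd e) m + {e}) := by
  refine Balanced.isProductOne ⟨Multiset.replicate (m - reflInd e) (sr 0, true) +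
    Multiset.replicate m (sr 1, false) + {(e, true)}, by simp [pairSeq], ?_⟩ ?_
  · rw [svecSum_add, svecSum_add, svecSum_replicate, svecSum_replicate]
    ext
    · simp [he]
    · simp [Nat.cast_sub hd.le]
      ring
  · simp; omega

lemma isProductOne_pairSeq_add_large (he : coord e = m) (hm : m < n) :
    IsProductOne (pairSeq n (n - m + reflInd e) (n - m) + {e}) := by
  refine Balanced.isProductOne ⟨Multiset.replicate (n - m + reflInd e) (sr 0, false) +
    Multiset.replicate (n - m) (sr 1, true) + {(e, true)}, by simp [pairSeq], ?_⟩ ?_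
  · rw [svecSum_add, svecSum_add, svecSum_replicate, svecSum_replicate]
    ext
    · simp [he, Nat.cast_sub hm.le]
    · simp
  · simp; omega

/-- An atom test for sequences containing `e` once: it suffices to consider the decompositions
whose first part contains `e`. -/
lemma isAtomSeq_pairSeq_add (h1 : 1 < n) {a b : ℕ} (h : IsProductOne (pairSeq n a b + {e}))
    (hdec : ∀ x y x' y', x + x' = a → y + y' = b → IsProductOne (pairSeq n x y + {e}) →
      IsProductOne (pairSeq n x' y') → x' = 0 ∧ y' = 0) :
    IsAtomSeq (pairSeq n a b + {e}) := by
  have key : ∀ A B : Multiset (DihedralGroup n), A + B = pairSeq n a b + {e} → e ∈ A →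
      IsProductOne A → IsProductOne B → B = 0 := by
    intro A B hAB heA hA hB
    obtain ⟨x, y, x', y', rfl, rfl, hx, hy⟩ := exists_of_add_eq_pairSeq_add h1 hAB heA
    obtain ⟨rfl, rfl⟩ := hdec x y x' y' hx hy hA hB
    exact pairSeq_zero
  refine ⟨by simp, h, fun A B hAB hA hB => ?_⟩
  have hmem : e ∈ A + B := by rw [← hAB]; simp
  rcases Multiset.mem_add.1 hmem with heA | heB
  · exact Or.inr (key A B hAB.symm heA hA hB)
  · exact Or.inl (key B A (by rw [add_comm, hAB]) heB hB hA)

lemma isAtomSeq_pairSeq_add_small (hn : Odd n) (he : coord e = m) (hm : m < n)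
    (hd : reflInd e < m) : IsAtomSeq (pairSeq n (m - reflInd e) m + {e}) := by
  refine isAtomSeq_pairSeq_add (by omega) (isProductOne_pairSeq_add_small he hd) ?_
  intro x y x' y' hx hy h h'
  have c1 := h.pairSeq_add_cases hn he hm hd
  have c2 := h'.pairSeq_cases
  omega

lemma isAtomSeq_pairSeq_add_large (hn : Odd n) (he : coord e = m) (hm : m < n)
    (hd : reflInd e < m) : IsAtomSeq (pairSeq n (n - m + reflInd e) (n - m) + {e}) := by
  refine isAtomSeq_pairSeq_add (by omega) (isProductOne_pairSeq_add_large he hm) ?_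
  intro x y x' y' hx hy h h'
  have c1 := h.pairSeq_add_cases hn he hm hd
  have c2 := h'.pairSeq_cases
  obtain ⟨k, hk⟩ := hn
  omega

lemma IsAtomSeq.pairSeq_add_cases (hn : Odd n) (he : coord e = m) (hm : m < n)
    (hd : reflInd e < m) {x y : ℕ} (h : IsAtomSeq (pairSeq n x y + {e})) :
    (x = m - reflInd e ∧ y = m) ∨ (x = n - m + reflInd e ∧ y = n - m) := by
  have split : ∀ a b c d, a + 2 * c = x → b + 2 * d = y → IsProductOne (pairSeq n a b + {e}) →
      x = a ∧ y = b := by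
    rintro a b c d rfl rfl hab
    rcases h.2.2 (pairSeq n a b + {e}) (pairSeq n (2 * c) (2 * d))
      (by rw [← pairSeq_add]; abel) hab (isProductOne_pairSeq_even c d) with h0 | h0
    · simp at h0
    · have := pairSeq_eq_zero h0
      omega
  obtain ⟨k, hk⟩ := id hn
  rcases h.2.1.pairSeq_add_cases hn he hm hd with ⟨h1, h2, h3, h4⟩ | ⟨h1, h2, h3, h4⟩
  · exact Or.inl (split _ _ ((x + reflInd e - m) / 2) ((y - m) / 2) (by omega) (by omega)
      (isProductOne_pairSeq_add_small he hd))
  · exact Or.inr (split _ _ ((x + m - n - reflInd e) / 2) ((y + m - n) / 2) (by omega) (by omega)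
      (isProductOne_pairSeq_add_large he hm))

lemma exists_catenaryAt_eq_of_coord (hn : Odd n) (he : coord e = m) (hm : m < n)
    (hd : reflInd e < m) :
    ∃ A : Multiset (DihedralGroup n), IsProductOne A ∧
      catenaryAt A = ((2 * m + 1 - reflInd e : ℕ) : ℕ∞) := by
  have h1 : 1 < n := by
    obtain ⟨k, hk⟩ := hn
    omega
  set d := reflInd e with hde
  set V₁ := pairSeq n (m - d) m + {e} with hV₁
  set V₂ := pairSeq n (n - m + d) (n - m) + {e} with hV₂
  have a₁ : IsAtomSeq V₁ := isAtomSeq_pairSeq_add_small hn he hm hd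
  have a₂ : IsAtomSeq V₂ := isAtomSeq_pairSeq_add_large hn he hm hd
  have aP := isAtomSeq_pairSeq_self hn h1
  have f₁ := a₁.isFactorization.add aP.isFactorization
  have f₂ := a₂.isFactorization.add (isFactorization_pairFact hn h1 0 (m - d) m)
  have hA₁ : V₁ + pairSeq n n n = pairSeq n (n + m - d) (n + m) + {e} := by
    rw [hV₁, add_right_comm, pairSeq_add]
    congr 2 <;> omega
  have hA₂ : V₂ + pairSeq n (n * 0 + 2 * (m - d)) (n * 0 + 2 * m) =
      pairSeq n (n + m - d) (n + m) + {e} := by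
    rw [hV₂, add_right_comm, pairSeq_add]
    congr 2 <;> omega
  rw [hA₁] at f₁
  rw [hA₂] at f₂
  refine ⟨_, f₁.isProductOne, catenaryAt_eq_of_two (by omega) f₁ f₂ ?_ ?_⟩
  · intro z hz
    have hmem : e ∈ z.sum := by rw [hz.2]; simp
    obtain ⟨U, hU, heU⟩ := Multiset.mem_join.1 hmem
    obtain ⟨w, B, rfl, hB, hw⟩ := hz.exists_cons hU
    obtain ⟨x, y, x', y', rfl, rfl, hx, hy⟩ := exists_of_add_eq_pairSeq_add h1 hB.symm heU
    rcases (hz.1 _ hU).pairSeq_add_cases hn he hm hd with ⟨rfl, rfl⟩ | ⟨rfl, rfl⟩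
    · left
      obtain rfl : x' = n := by omega
      obtain rfl : y' = x' := by omega
      rw [aP.eq_singleton_of_isFactorization hw, ← Multiset.singleton_add]
    · right
      obtain ⟨i, j, k, rfl, hj, hk⟩ := hw.exists_eq_pairFact hn h1
      obtain ⟨l, hl⟩ := hn
      have hi : i < 2 := by
        by_contra! hi
        nlinarith
      obtain rfl : i = 0 := by
        interval_cases i <;> omega
      obtain rfl : j = m - d := by omega
      obtain rfl : k = m := by omega
      rw [← Multiset.singleton_add]
  · have hnot := notMem_pairSeq he hm hd
    have heV₁ : e ∈ V₁ := by simp [hV₁]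
    have heV₂ : e ∈ V₂ := by simp [hV₂]
    rw [factDist_of_disjoint]
    · simp [pairFact]
      omega
    · intro U hU hU'
      simp only [pairFact, Multiset.replicate_zero, zero_add, Multiset.mem_add,
        Multiset.mem_singleton, Multiset.mem_replicate] at hU hU'
      rcases hU with rfl | rfl
      · rcases hU' with h | ⟨-, h⟩ | ⟨-, h⟩
        · have := (pairSeq_injective h1 (add_right_cancel h)).2
          obtain ⟨k, hk⟩ := hn
          omega
        · exact hnot _ _ (h ▸ heV₁)
        · exact hnot _ _ (h ▸ heV₁)
      · rcases hU' with h | ⟨-, h⟩ | ⟨-, h⟩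
        · exact hnot _ _ (h ▸ heV₂)
        · have := pairSeq_injective h1 h
          omega
        · have := pairSeq_injective h1 h
          omega

end Distinguished

lemma exists_catenaryAt_eq (hn : Odd n) (h3 : 3 ≤ n) {k : ℕ} (h2 : 2 ≤ k) (hk : k ≤ 2 * n) :
    ∃ A : Multiset (DihedralGroup n), IsProductOne A ∧ catenaryAt A = k := by
  rcases eq_or_ne k 2 with rfl | hk2
  · exact exists_catenaryAt_eq_two h3
  rcases eq_or_ne k (2 * n) with rfl | hkn
  · exact exists_catenaryAt_eq_two_mul hn h3
  rcases Nat.even_or_odd' k with ⟨m, rfl | rfl⟩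
  · exact exists_catenaryAt_eq_of_coord (e := sr (m : ZMod n)) (m := m) hn (by simp) (by omega)
      (by simp; omega)
  · exact exists_catenaryAt_eq_of_coord (e := r (m : ZMod n)) (m := m) hn (by simp) (by omega)
      (by simp; omega)

end Realization

end ProductOne

open ProductOne in
/-- Let `G` be a dihedral group of order `2n`, `n ≥ 3` odd. Then the
set of positive catenary degrees `Ca(G)` equals the integer interval `[2, 2n]`. -/
theorem catenarySet_dihedral_eq_interval (n : ℕ) (hn : 3 ≤ n) (hodd : Odd n) :
    CatenarySet (DihedralGroup n) = {c : ℕ∞ | 2 ≤ c ∧ c ≤ ((2 * n : ℕ) : ℕ∞)} := by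
  ext c
  constructor
  · rintro ⟨A, -, rfl, hpos⟩
    exact ⟨two_le_catenaryAt hpos, catenaryAt_le hodd hn A⟩
  · rintro ⟨h2, hle⟩
    lift c to ℕ using (lt_of_le_of_lt hle (ENat.natCast_lt_top _)).ne
    obtain ⟨A, hA, hc⟩ := exists_catenaryAt_eq hodd hn (k := c) (by exact_mod_cast h2)
      (by exact_mod_cast hle)
    exact ⟨A, hA, hc, lt_of_lt_of_le (by norm_num) h2⟩
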